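/- For every nonnegative integer a, the number of cyclically symmetric plane partitions contained in a 2a×2a×2a box equals the number of totally symmetric plane partitions contained in that box multiplied by the number of plane partitions contained in that box which are both cyclically symmetric and transpose-complementary. (Equation (1.3): CS(2a,2a,2a) = TS(2a,2a,2a)·CSTC(2a,2a,2a).) -/

import Mathlib

/-- The transpose of (the diagram of) a plane partition contained in an `a × a × c` box:
`(i,j,k)` is in the transpose iff `(j,i,k)` is in `T`. -/
def ppTranspose {a c : ℕ} (T : Set (Fin a × Fin a × Fin c)) : Set (Fin a × Fin a × Fin c) :=
  {x | (x.2.1, x.1, x.2.2) ∈ T}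

/-- The cyclic shift of (the diagram of) a plane partition contained in an `n × n × n` box:
`(i,j,k)` is in the shift iff `(j,k,i)` is in `T`.  `T` is cyclically symmetric iff it equals
its cyclic shift. -/
def ppCycle {n : ℕ} (T : Set (Fin n × Fin n × Fin n)) : Set (Fin n × Fin n × Fin n) :=
  {x | (x.2.1, x.2.2, x.1) ∈ T}

/-- The complement of (the diagram of) a plane partition contained in an `a × b × c` box:
`(i,j,k)` is in the complement iff `(a-1-i, b-1-j, c-1-k)` is not in `T`. -/
def ppComplement {a b c : ℕ} (T : Set (Fin a × Fin b × Fin c)) : Set (Fin a × Fin b × Fin c) :=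
  {x | (x.1.rev, x.2.1.rev, x.2.2.rev) ∉ T}

namespace PP

abbrev Vec := ℕ → ℤ
abbrev F (n : ℕ) := (Fin n → Bool) → ℤ

def tl (w : Vec) : Vec := fun i => w (i + 1)

def e0 {n : ℕ} : F (n + 1) →ₗ[ℤ] F n where
  toFun f := fun t => f (Fin.cons false t)
  map_add' _ _ := rfl
  map_smul' _ _ := rfl

def e1 {n : ℕ} : F (n + 1) →ₗ[ℤ] F n where
  toFun f := fun t => f (Fin.cons true t)
  map_add' _ _ := rfl
  map_smul' _ _ := rfl

def mk {n : ℕ} {A : Type*} [AddCommGroup A] (f g : A →ₗ[ℤ] F n) : A →ₗ[ℤ] F (n + 1) where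
  toFun x := fun t => if t 0 then g x (Fin.tail t) else f x (Fin.tail t)
  map_add' x y := by
    funext t
    simp only [map_add, Pi.add_apply]
    split <;> rfl
  map_smul' m x := by
    funext t
    simp only [map_smul, Pi.smul_apply]
    split <;> rfl

@[simp] lemma e0_mk {n : ℕ} {A : Type*} [AddCommGroup A] (f g : A →ₗ[ℤ] F n) (x : A) :
    e0 (mk f g x) = f x := by
  funext t; simp [e0, mk]

@[simp] lemma e1_mk {n : ℕ} {A : Type*} [AddCommGroup A] (f g : A →ₗ[ℤ] F n) (x : A) :
    e1 (mk f g x) = g x := by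
  funext t; simp [e1, mk]

lemma F_ext {n : ℕ} {f g : F (n + 1)} (h0 : e0 f = e0 g) (h1 : e1 f = e1 g) : f = g := by
  funext t
  rw [← Fin.cons_self_tail t]
  cases h : t 0
  · exact congrFun h0 (Fin.tail t)
  · exact congrFun h1 (Fin.tail t)

/-- creation -/
def cr : (n : ℕ) → Vec → (F n →ₗ[ℤ] F n)
  | 0, _ => 0
  | n + 1, w => mk ((cr n (tl w)).comp e0) (w 0 • e0 - (cr n (tl w)).comp e1)

/-- annihilation -/
def an : (n : ℕ) → Vec → (F n →ₗ[ℤ] F n)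
  | 0, _ => 0
  | n + 1, w => mk ((an n (tl w)).comp e0 + w 0 • e1) (- (an n (tl w)).comp e1)

/-- parity -/
def ch : (n : ℕ) → (F n →ₗ[ℤ] F n)
  | 0 => LinearMap.id
  | n + 1 => mk ((ch n).comp e0) (- (ch n).comp e1)

def vac (n : ℕ) : F n := fun t => if ∀ i, t i = false then 1 else 0

def ip : ℕ → Vec → Vec → ℤ
  | 0, _, _ => 0
  | n + 1, u, w => u 0 * w 0 + ip n (tl u) (tl w)

@[simp] lemma e0_cr (n : ℕ) (w : Vec) (f : F (n + 1)) : e0 (cr (n + 1) w f) = cr n (tl w) (e0 f) := by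
  simp [cr]
@[simp] lemma e1_cr (n : ℕ) (w : Vec) (f : F (n + 1)) :
    e1 (cr (n + 1) w f) = w 0 • e0 f - cr n (tl w) (e1 f) := by
  simp [cr]
@[simp] lemma e0_an (n : ℕ) (w : Vec) (f : F (n + 1)) :
    e0 (an (n + 1) w f) = an n (tl w) (e0 f) + w 0 • e1 f := by
  simp [an]
@[simp] lemma e1_an (n : ℕ) (w : Vec) (f : F (n + 1)) :
    e1 (an (n + 1) w f) = - an n (tl w) (e1 f) := by
  simp [an]
@[simp] lemma e0_ch (n : ℕ) (f : F (n + 1)) : e0 (ch (n + 1) f) = ch n (e0 f) := by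
  simp [ch]
@[simp] lemma e1_ch (n : ℕ) (f : F (n + 1)) : e1 (ch (n + 1) f) = - ch n (e1 f) := by
  simp [ch]
@[simp] lemma e0_vac (n : ℕ) : e0 (vac (n + 1)) = vac n := by
  funext t
  simp [e0, vac, Fin.forall_fin_succ]
@[simp] lemma e1_vac (n : ℕ) : e1 (vac (n + 1)) = 0 := by
  funext t
  simp [e1, vac, Fin.forall_fin_succ]

lemma tl_add (u v : Vec) : tl (u + v) = tl u + tl v := rfl
lemma tl_smul (k : ℤ) (v : Vec) : tl (k • v) = k • tl v := rfl
lemma tl_zero : tl 0 = 0 := rfl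

lemma cr_add (n : ℕ) (u v : Vec) (f : F n) : cr n (u + v) f = cr n u f + cr n v f := by
  induction n generalizing u v with
  | zero => simp [cr]
  | succ n ih =>
    apply F_ext
    · simp [tl_add, ih]
    · simp [tl_add, ih, add_smul]; abel

lemma cr_smul (n : ℕ) (k : ℤ) (v : Vec) (f : F n) : cr n (k • v) f = k • cr n v f := by
  induction n generalizing v with
  | zero => simp [-zsmul_eq_mul, cr]
  | succ n ih =>
    apply F_ext
    · simp [-zsmul_eq_mul, tl_smul, ih]
    · simp [-zsmul_eq_mul, tl_smul, ih, mul_smul, smul_sub]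

def crL (n : ℕ) (f : F n) : Vec →ₗ[ℤ] F n where
  toFun w := cr n w f
  map_add' u v := cr_add n u v f
  map_smul' k v := cr_smul n k v f

lemma cr_anti (n : ℕ) (u v : Vec) (f : F n) : cr n u (cr n v f) = - cr n v (cr n u f) := by
  induction n generalizing u v with
  | zero => simp [-zsmul_eq_mul, cr]
  | succ n ih =>
    apply F_ext
    · simp [-zsmul_eq_mul, ih (tl u) (tl v)]
    · simp [-zsmul_eq_mul, ih (tl u) (tl v)]; abel

lemma cr_sq (n : ℕ) (u : Vec) (f : F n) : cr n u (cr n u f) = 0 := by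
  have h := cr_anti n u u f
  funext t
  have := congrFun h t
  simp only [Pi.neg_apply, Pi.zero_apply] at *
  omega

lemma car (n : ℕ) (u v : Vec) (f : F n) :
    an n u (cr n v f) = ip n u v • f - cr n v (an n u f) := by
  induction n generalizing u v with
  | zero => simp [-zsmul_eq_mul, cr, an, ip]
  | succ n ih =>
    apply F_ext
    · simp [-zsmul_eq_mul, ih (tl u) (tl v), ip, add_smul, mul_smul, smul_sub]; abel
    · simp [-zsmul_eq_mul, ih (tl u) (tl v), ip, add_smul, mul_smul, smul_sub, smul_add]
      rw [smul_comm]; abel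

lemma an_vac (n : ℕ) (u : Vec) : an n u (vac n) = 0 := by
  induction n generalizing u with
  | zero => simp [-zsmul_eq_mul, an]
  | succ n ih => apply F_ext <;> simp [-zsmul_eq_mul, ih]

lemma ch_cr (n : ℕ) (u : Vec) (f : F n) : ch n (cr n u f) = - cr n u (ch n f) := by
  induction n generalizing u with
  | zero => simp [-zsmul_eq_mul, cr]
  | succ n ih =>
    apply F_ext
    · simp [-zsmul_eq_mul, ih]
    · simp [-zsmul_eq_mul, ih]

lemma ch_an (n : ℕ) (u : Vec) (f : F n) : ch n (an n u f) = - an n u (ch n f) := by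
  induction n generalizing u with
  | zero => simp [-zsmul_eq_mul, an]
  | succ n ih =>
    apply F_ext
    · simp [-zsmul_eq_mul, ih]; abel
    · simp [-zsmul_eq_mul, ih]

lemma ch_vac (n : ℕ) : ch n (vac n) = vac n := by
  induction n with
  | zero => simp [-zsmul_eq_mul, ch]
  | succ n ih => apply F_ext <;> simp [-zsmul_eq_mul, ih]

/-- inner product of states -/
def ipF {n : ℕ} (f g : F n) : ℤ := ∑ t, f t * g t

lemma sum_split {n : ℕ} (f : F (n + 1)) : ∑ t, f t = ∑ t, e0 f t + ∑ t, e1 f t := by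
  rw [← (Fin.consEquiv (fun _ => Bool)).sum_comp, Fintype.sum_prod_type]
  simp [Fin.consEquiv, e0, e1, add_comm]

lemma ipF_succ {n : ℕ} (f g : F (n + 1)) : ipF f g = ipF (e0 f) (e0 g) + ipF (e1 f) (e1 g) :=
  sum_split (fun t => f t * g t)

lemma ipF_add_right {n : ℕ} (f g h : F n) : ipF f (g + h) = ipF f g + ipF f h := by
  simp [ipF, mul_add, Finset.sum_add_distrib]
lemma ipF_add_left {n : ℕ} (f g h : F n) : ipF (f + g) h = ipF f h + ipF g h := by
  simp [ipF, add_mul, Finset.sum_add_distrib]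
lemma ipF_smul_right {n : ℕ} (k : ℤ) (f g : F n) : ipF f (k • g) = k * ipF f g := by
  simp only [ipF, Finset.mul_sum, Pi.smul_apply, smul_eq_mul]
  exact Finset.sum_congr rfl fun _ _ => by ring
lemma ipF_smul_left {n : ℕ} (k : ℤ) (f g : F n) : ipF (k • f) g = k * ipF f g := by
  simp only [ipF, Finset.mul_sum, Pi.smul_apply, smul_eq_mul]
  exact Finset.sum_congr rfl fun _ _ => by ring
lemma ipF_neg_right {n : ℕ} (f g : F n) : ipF f (-g) = - ipF f g := by
  simp [ipF]
lemma ipF_neg_left {n : ℕ} (f g : F n) : ipF (-f) g = - ipF f g := by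
  simp [ipF]
lemma ipF_zero_right {n : ℕ} (f : F n) : ipF f 0 = 0 := by
  simp [ipF]
lemma ipF_sum_right {n : ℕ} {ι : Type*} (s : Finset ι) (f : F n) (g : ι → F n) :
    ipF f (∑ i ∈ s, g i) = ∑ i ∈ s, ipF f (g i) := by
  classical
  induction s using Finset.induction_on with
  | empty => simp [ipF]
  | insert a s ha ih => rw [Finset.sum_insert ha, Finset.sum_insert ha, ipF_add_right, ih]

lemma ipF_cr (n : ℕ) (u : Vec) (f g : F n) : ipF (cr n u f) g = ipF f (an n u g) := by
  induction n generalizing u with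
  | zero => simp [cr, an, ipF]
  | succ n ih =>
    rw [ipF_succ, ipF_succ]
    simp only [e0_cr, e1_cr, e0_an, e1_an, sub_eq_add_neg, ipF_add_left, ipF_add_right,
      ipF_smul_left, ipF_smul_right, ipF_neg_left, ipF_neg_right, ih]
    ring

lemma ipF_vac (n : ℕ) : ipF (vac n) (vac n) = 1 := by
  induction n with
  | zero => simp [ipF, vac]
  | succ n ih => rw [ipF_succ]; simp [ih, ipF_zero_right]

lemma ipF_self_nonneg {n : ℕ} (f : F n) : 0 ≤ ipF f f :=
  Finset.sum_nonneg fun _ _ => mul_self_nonneg _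

/-- product of creation operators -/
def W (n : ℕ) : (a : ℕ) → (Fin a → Vec) → F n → F n
  | 0, _, f => f
  | a + 1, u, f => cr n (u 0) (W n a (Fin.tail u) f)

lemma W_add (n a : ℕ) (u : Fin a → Vec) (f g : F n) : W n a u (f + g) = W n a u f + W n a u g := by
  induction a with
  | zero => rfl
  | succ a ih => simp [W, ih]
lemma W_smul (n a : ℕ) (u : Fin a → Vec) (k : ℤ) (f : F n) : W n a u (k • f) = k • W n a u f := by
  induction a with
  | zero => rfl
  | succ a ih => simp [-zsmul_eq_mul, W, ih]

def WL (n a : ℕ) (u : Fin a → Vec) : F n →ₗ[ℤ] F n where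
  toFun := W n a u
  map_add' := W_add n a u
  map_smul' := W_smul n a u

lemma WL_apply (n a : ℕ) (u : Fin a → Vec) (f : F n) : WL n a u f = W n a u f := rfl

lemma tail_succAbove_succ {α : Type*} {a : ℕ} (u : Fin (a + 2) → α) (j : Fin (a + 1)) :
    Fin.tail (u ∘ Fin.succAbove j.succ) = (Fin.tail u) ∘ Fin.succAbove j := by
  funext i; simp [Fin.tail]

lemma an_W (n a : ℕ) (x : Vec) (u : Fin (a + 1) → Vec) (b : F n) (hb : an n x b = 0) :
    an n x (W n (a + 1) u b) =
      ∑ j : Fin (a + 1), ((-1) ^ (j : ℕ) * ip n x (u j)) • W n a (u ∘ j.succAbove) b := by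
  induction a with
  | zero => simp [W, car, hb]
  | succ a ih =>
    rw [W, car, ih, map_sum, Fin.sum_univ_succ (n := a + 1), sub_eq_add_neg, ← Finset.sum_neg_distrib]
    congr 1
    · simp [-zsmul_eq_mul]; rfl
    · refine Finset.sum_congr rfl fun j _ => ?_
      rw [map_smul, W, tail_succAbove_succ]
      simp [-zsmul_eq_mul, Fin.tail, pow_succ]

lemma gram (n a : ℕ) (u v : Fin a → Vec) (f g : F n) (h : ∀ i, an n (u i) g = 0) :
    ipF (W n a u f) (W n a v g) = Matrix.det (Matrix.of fun i j => ip n (u i) (v j)) * ipF f g := by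
  induction a with
  | zero => simp [W]
  | succ a ih =>
    rw [W, ipF_cr, an_W _ _ _ _ _ (h 0), ipF_sum_right, Matrix.det_succ_row_zero, Finset.sum_mul]
    refine Finset.sum_congr rfl fun j _ => ?_
    rw [ipF_smul_right, ih (Fin.tail u) _ (fun i => h i.succ)]
    simp only [Matrix.of_apply, mul_assoc]
    rfl

lemma an_W_zero (n a : ℕ) (x : Vec) (u : Fin a → Vec) (b : F n) (hb : an n x b = 0)
    (hu : ∀ i, ip n x (u i) = 0) : an n x (W n a u b) = 0 := by
  cases a with
  | zero => exact hb
  | succ a => rw [an_W _ _ _ _ _ hb]; simp [hu]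

lemma an_W_comm (n a : ℕ) (x : Vec) (u : Fin a → Vec) (b : F n)
    (hu : ∀ i, ip n x (u i) = 0) : an n x (W n a u b) = (-1) ^ a • W n a u (an n x b) := by
  induction a with
  | zero => simp [W]
  | succ a ih =>
    rw [W, car, hu, ih (Fin.tail u) (fun i => hu i.succ), W, map_smul]
    simp [pow_succ]

lemma ch_W (n a : ℕ) (u : Fin a → Vec) (b : F n) :
    ch n (W n a u b) = (-1) ^ a • W n a u (ch n b) := by
  induction a with
  | zero => simp [W]
  | succ a ih => rw [W, ch_cr, ih, W, map_smul]; simp [pow_succ]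

end PP

namespace PP

lemma an_add (n : ℕ) (u v : Vec) (f : F n) : an n (u + v) f = an n u f + an n v f := by
  induction n generalizing u v with
  | zero => simp [an]
  | succ n ih =>
    apply F_ext
    · simp [-zsmul_eq_mul, tl_add, ih, add_smul]; abel
    · simp [-zsmul_eq_mul, tl_add, ih]; abel

lemma an_smul (n : ℕ) (k : ℤ) (v : Vec) (f : F n) : an n (k • v) f = k • an n v f := by
  induction n generalizing v with
  | zero => simp [an]
  | succ n ih =>
    apply F_ext
    · simp [-zsmul_eq_mul, tl_smul, ih, mul_smul]
    · simp [-zsmul_eq_mul, tl_smul, ih]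

/-- signed sum functional -/
def Ph : (n : ℕ) → Vec → (F n →ₗ[ℤ] ℤ)
  | 0, _ => LinearMap.proj (fun i => i.elim0)
  | n + 1, s => (Ph n (tl s)).comp e0 +
      (if s 0 = 1 then (Ph n (tl s)).comp e1 else - ((Ph n (tl s)).comp (ch n)).comp e1)

lemma Ph_succ (n : ℕ) (s : Vec) (f : F (n + 1)) : Ph (n + 1) s f = Ph n (tl s) (e0 f) +
    (if s 0 = 1 then Ph n (tl s) (e1 f) else - Ph n (tl s) (ch n (e1 f))) := by
  simp only [Ph]
  split <;> simp

def xi : ℕ → Vec → Vec → Vec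
  | 0, _, _ => 0
  | n + 1, s, u => fun i => match i with
    | 0 => - ip n (tl s) (tl u)
    | i + 1 => xi n (tl s) (tl u) i + u 0 * s (i + 1)

lemma tl_xi (n : ℕ) (s u : Vec) : tl (xi (n + 1) s u) = xi n (tl s) (tl u) + u 0 • tl s := rfl
lemma xi_zero (n : ℕ) (s u : Vec) : xi (n + 1) s u 0 = - ip n (tl s) (tl u) := rfl

lemma ch_even {n : ℕ} {f : F (n + 1)} (h : ch (n + 1) f = f) :
    ch n (e0 f) = e0 f ∧ ch n (e1 f) = - e1 f := by
  constructor
  · rw [← e0_ch, h]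
  · have := e1_ch n f
    rw [h] at this
    exact neg_eq_iff_eq_neg.mp this.symm

lemma ch_odd {n : ℕ} {f : F (n + 1)} (h : ch (n + 1) f = - f) :
    ch n (e0 f) = - e0 f ∧ ch n (e1 f) = e1 f := by
  constructor
  · rw [← e0_ch, h, map_neg]
  · have := e1_ch n f
    rw [h, map_neg] at this
    exact (neg_injective this).symm

lemma Ph_tau (n : ℕ) (s : Vec) (hs : ∀ i, s i = 1 ∨ s i = -1) (f : F n) :
    (ch n f = f → Ph n s (an n s f) = 0) ∧ (ch n f = - f → Ph n s (an n s f) = Ph n s f) := by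
  induction n generalizing s with
  | zero =>
    refine ⟨fun h => by simp [an], fun h => ?_⟩
    have : f = 0 := by
      funext t
      have := congrFun h t
      simp [ch] at this ⊢
      omega
    simp [this]
  | succ n ih =>
    have ih := ih (tl s) (fun i => hs _)
    refine ⟨fun h => ?_, fun h => ?_⟩
    · obtain ⟨h0, h1⟩ := ch_even h
      have i0 := (ih (e0 f)).1 h0
      have i1 := (ih (e1 f)).2 h1
      rw [Ph_succ, e0_an, e1_an, map_neg (ch n), ch_an, h1]
      simp only [map_add, map_neg, map_smul, i0, i1]
      rcases hs 0 with h | h <;> simp [h]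
    · obtain ⟨h0, h1⟩ := ch_odd h
      have i0 := (ih (e0 f)).2 h0
      have i1 := (ih (e1 f)).1 h1
      rw [Ph_succ, Ph_succ, e0_an, e1_an, map_neg (ch n), ch_an, h1]
      simp only [map_add, map_neg, map_smul, i0, i1]
      rcases hs 0 with h | h <;> simp [h]

lemma Ph_pf (n : ℕ) (s : Vec) (hs : ∀ i, s i = 1 ∨ s i = -1) (u : Vec) (f : F n) :
    (ch n f = f → Ph n s (cr n u f) = Ph n s (an n (xi n s u) f) + ip n s u * Ph n s f) ∧
    (ch n f = - f → Ph n s (cr n u f) = Ph n s (an n (xi n s u) f)) := by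
  induction n generalizing s u with
  | zero => simp [an, cr, ip]
  | succ n ih =>
    have ih := ih (tl s) (fun i => hs _) (tl u)
    have tau := Ph_tau n (tl s) (fun i => hs _)
    refine ⟨fun h => ?_, fun h => ?_⟩
    · obtain ⟨h0, h1⟩ := ch_even h
      have i0 := (ih (e0 f)).1 h0
      have i1 := (ih (e1 f)).2 h1
      have t0 := (tau (e0 f)).1 h0
      have t1 := (tau (e1 f)).2 h1
      rw [Ph_succ, Ph_succ, Ph_succ, e0_an, e1_an, e0_cr, e1_cr, map_neg (ch n), ch_an, map_sub (ch n),
        ch_cr, map_smul (ch n), h0, h1, tl_xi, xi_zero, an_add, an_smul, an_add, an_smul,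
        an_add, an_smul]
      simp only [map_add, map_neg, map_smul, map_sub, i0, i1, t0, t1, smul_eq_mul, ip]
      rcases hs 0 with h | h
      · simp [h]; ring
      · simp [h]; ring
    · obtain ⟨h0, h1⟩ := ch_odd h
      have i0 := (ih (e0 f)).2 h0
      have i1 := (ih (e1 f)).1 h1
      have t0 := (tau (e0 f)).2 h0
      have t1 := (tau (e1 f)).1 h1
      rw [Ph_succ, Ph_succ, e0_an, e1_an, e0_cr, e1_cr, map_neg (ch n), ch_an, map_sub (ch n),
        ch_cr, map_smul (ch n), h0, h1, tl_xi, xi_zero, an_add, an_smul, an_add, an_smul]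
      simp only [map_add, map_neg, map_smul, map_sub, i0, i1, t0, t1, smul_eq_mul]
      rcases hs 0 with h | h
      · simp [h]; ring
      · simp [h]; ring

lemma Ph_vac (n : ℕ) (s : Vec) : Ph n s (vac n) = 1 := by
  induction n generalizing s with
  | zero => simp [Ph, vac]
  | succ n ih => simp [Ph_succ, ih]

lemma pf_det (n : ℕ) (s : Vec) (hs : ∀ i, s i = 1 ∨ s i = -1) (a : ℕ) :
    ∃ ε : ℤ, ε * ε = 1 ∧ ∀ u v : Fin a → Vec, (∀ i j, ip n (xi n s (u i)) (u j) = 0) →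
      Ph n s (W n a u (W n a v (vac n))) =
        ε * Matrix.det (Matrix.of fun i j => ip n (xi n s (u i)) (v j)) := by
  induction a with
  | zero => exact ⟨1, by simp, fun u v _ => by simp [W, Ph_vac]⟩
  | succ a ih =>
    obtain ⟨ε, hε, ih⟩ := ih
    refine ⟨(-1) ^ a * ε, ?_, fun u v h => ?_⟩
    · have : ((-1 : ℤ) ^ a) * (-1) ^ a = 1 := by rw [← mul_pow]; simp
      linear_combination ε * ε * this + hε
    · have hodd : ch n (W n a (Fin.tail u) (W n (a + 1) v (vac n))) =
          - (W n a (Fin.tail u) (W n (a + 1) v (vac n))) := by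
        rw [ch_W, ch_W, W_smul, smul_smul, ch_vac, ← pow_add]
        have : (-1 : ℤ) ^ (a + (a + 1)) = -1 := Odd.neg_one_pow ⟨a, by ring⟩
        rw [this, neg_one_smul]
      rw [W, (Ph_pf n s hs (u 0) _).2 hodd, an_W_comm _ _ _ (Fin.tail u) _ (fun i => h 0 i.succ),
        an_W _ _ _ _ _ (an_vac _ _), ← WL_apply, map_smul, map_sum, map_sum,
        Matrix.det_succ_row_zero, mul_assoc, smul_eq_mul, Finset.mul_sum, Finset.mul_sum, Finset.mul_sum]
      refine Finset.sum_congr rfl fun j _ => ?_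
      rw [map_smul, map_smul, WL_apply, ih (Fin.tail u) _ (fun i j => h i.succ j.succ)]
      simp only [Matrix.of_apply, smul_eq_mul]
      have : (Matrix.of fun i k => ip n (xi n s (Fin.tail u i)) ((v ∘ j.succAbove) k)) =
        (Matrix.of fun i j => ip n (xi n s (u i)) (v j)).submatrix Fin.succ j.succAbove := rfl
      rw [this]; ring

def QQ (n : ℕ) (s u w : Vec) : ℤ := ip n (xi n s u) w

lemma ip_add_left (n : ℕ) (u v w : Vec) : ip n (u + v) w = ip n u w + ip n v w := by
  induction n generalizing u v w with
  | zero => simp [ip]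
  | succ n ih => simp [ip, tl_add, ih]; ring
lemma ip_comm (n : ℕ) (u v : Vec) : ip n u v = ip n v u := by
  induction n generalizing u v with
  | zero => simp [ip]
  | succ n ih => simp [ip, ih (tl u)]; ring
lemma ip_smul_left (n : ℕ) (k : ℤ) (u w : Vec) : ip n (k • u) w = k * ip n u w := by
  induction n generalizing u w with
  | zero => simp [ip]
  | succ n ih => simp [ip, tl_smul, ih, -zsmul_eq_mul]; ring
lemma ip_neg_left (n : ℕ) (u w : Vec) : ip n (-u) w = - ip n u w := by
  have := ip_smul_left n (-1) u w
  rwa [neg_one_smul, neg_one_mul] at this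
lemma ip_neg_right (n : ℕ) (u w : Vec) : ip n u (-w) = - ip n u w := by
  rw [ip_comm, ip_neg_left, ip_comm]

lemma QQ_succ (n : ℕ) (s u w : Vec) : QQ (n + 1) s u w =
    QQ n (tl s) (tl u) (tl w) + u 0 * ip n (tl s) (tl w) - ip n (tl s) (tl u) * w 0 := by
  simp only [QQ]
  rw [ip, tl_xi, xi_zero, ip_add_left, ip_smul_left]; ring

def app (k : ℕ) (p q : Vec) : Vec := fun i => if i < k then p i else q (i - k)

lemma app_zero (p q : Vec) : app 0 p q = q := by
  funext i; simp [app]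
lemma app_succ_zero (k : ℕ) (p q : Vec) : app (k + 1) p q 0 = p 0 := by
  simp [app]
lemma tl_app (k : ℕ) (p q : Vec) : tl (app (k + 1) p q) = app k (tl p) q := by
  funext i; simp [app, tl]

def one : Vec := fun _ => 1

lemma tl_one : tl one = one := rfl
lemma tl_neg_one : tl (-one) = -one := rfl

lemma ip_app (n k : ℕ) (p q p' q' : Vec) :
    ip (n + k) (app k p q) (app k p' q') = ip k p p' + ip n q q' := by
  induction k generalizing p p' with
  | zero => simp [app_zero, ip]
  | succ k ih =>
    rw [← add_assoc, ip, tl_app, tl_app, ih, app_succ_zero, app_succ_zero, ip]; ring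

lemma QQ_app (n k : ℕ) (p q p' q' : Vec) :
    QQ (n + k) (app k (-one) one) (app k p q) (app k p' q') =
      - QQ k one p p' + QQ n one q q' + ip k one p * ip n one q' - ip n one q * ip k one p' := by
  induction k generalizing p p' with
  | zero => simp [app_zero, QQ, xi, ip]
  | succ k ih =>
    rw [← add_assoc, QQ_succ, tl_app, tl_app, tl_app, tl_neg_one, ih, app_succ_zero, app_succ_zero, QQ_succ,
      ip_app, ip_app, ip_neg_left, ip_neg_left, ip, ip, tl_one]
    simp only [one]; ring

def BB (n : ℕ) (u w : Vec) : ℤ := QQ n one u w + ip n one u * ip n one w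

lemma BB_succ (n : ℕ) (u w : Vec) : BB (n + 1) u w =
    BB n (tl u) (tl w) + 2 * u 0 * ip n one (tl w) + u 0 * w 0 := by
  simp only [BB, QQ_succ, ip, tl_one]
  simp only [one]; ring

def sh (c : ℤ) (g : Vec) : Vec := fun i => match i with
  | 0 => c
  | i + 1 => g i

lemma ip_tele (n : ℕ) (g : Vec) : ip n one (g - tl g) = g 0 - g n := by
  induction n generalizing g with
  | zero => simp [ip]
  | succ n ih =>
    have : tl (g - tl g) = tl g - tl (tl g) := rfl
    rw [ip, this, tl_one, ih]; simp [one, tl]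

lemma BB_tele (n : ℕ) (z g : Vec) (c : ℤ) (hg : ∀ i, n ≤ i + 1 → g i = 0) :
    BB n z (sh c g - g) = ip n z (sh c g + g) := by
  induction n generalizing z g c with
  | zero => simp [BB, QQ, ip]
  | succ n ih =>
    have h1 : tl (sh c g - g) = g - tl g := rfl
    have h3 : tl (sh c g + g) = sh (g 0) (tl g) + tl g := by
      funext i; cases i <;> rfl
    have h2 : g - tl g = sh (g 0) (tl g) - tl g := by
      funext i; cases i <;> rfl
    rw [BB_succ, ip, h1, h3, ip_tele, h2, ih (tl z) (tl g) (g 0) (fun i hi => hg (i + 1) (by omega)), hg n (by omega)]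
    simp [sh]; ring

lemma ip_E (n : ℕ) (z h : Vec) (c : ℤ) (hh : ∀ i, n ≤ i → h i = 0) :
    ip n (z + 2 • sh c z) h = ip n z (h + 2 • tl h) + 2 * c * h 0 := by
  induction n generalizing z h c with
  | zero => simp [ip, hh 0]
  | succ n ih =>
    have h1 : tl (z + 2 • sh c z) = tl z + 2 • sh (z 0) (tl z) := by
      funext i; cases i <;> rfl
    have h2 : tl (h + 2 • tl h) = tl h + 2 • tl (tl h) := rfl
    rw [ip, h1, ih (tl z) (tl h) (z 0) (fun i hi => hh (i + 1) (by omega)), ip, h2]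
    simp [sh, tl]; ring

end PP

namespace PP
open Polynomial

/-- `V n u k f = cr (u 0) (cr (u 1) ... (cr (u (k-1)) f))` -/
def V (n : ℕ) (u : ℕ → Vec) : ℕ → F n → F n
  | 0, f => f
  | k + 1, f => V n u k (cr n (u k) f)

lemma W_snoc (n k : ℕ) (u : Fin (k + 1) → Vec) (f : F n) :
    W n (k + 1) u f = W n k (u ∘ Fin.castSucc) (cr n (u (Fin.last k)) f) := by
  induction k with
  | zero => rfl
  | succ k ih => rw [W, ih, W]; rfl

lemma V_eq_W (n k : ℕ) (u : ℕ → Vec) (f : F n) : V n u k f = W n k (fun i => u i) f := by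
  induction k generalizing f with
  | zero => rfl
  | succ k ih => rw [V, ih, W_snoc]; rfl

lemma V_smul (n k : ℕ) (u : ℕ → Vec) (c : ℤ) (f : F n) : V n u k (c • f) = c • V n u k f := by
  rw [V_eq_W, V_eq_W, W_smul]

lemma V_succ_left (n k : ℕ) (u : ℕ → Vec) (f : F n) :
    V n u (k + 1) f = cr n (u 0) (V n (fun i => u (i + 1)) k f) := by
  rw [V_eq_W, V_eq_W, W]; rfl

lemma V_rep (n k : ℕ) (u : ℕ → Vec) (j : ℕ) (hj : j < k) (f : F n) :
    V n u k (cr n (u j) f) = 0 := by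
  induction k generalizing f with
  | zero => omega
  | succ k ih =>
    rw [V]
    rcases eq_or_ne j k with rfl | h
    · rw [cr_sq, V_eq_W, ← WL_apply, map_zero]
    · rw [cr_anti, ← neg_one_smul ℤ, V_smul, ih (by omega), smul_zero]

lemma V_comm (n k : ℕ) (u : ℕ → Vec) (w : Vec) (f : F n) :
    V n u k (cr n w f) = (-1 : ℤ) ^ k • cr n w (V n u k f) := by
  induction k generalizing f with
  | zero => simp [V]
  | succ k ih =>
    rw [V, cr_anti, ← neg_one_smul ℤ, V_smul, ih, smul_smul, ← pow_succ', V]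

lemma V_tri (n k : ℕ) (L : ℤ[X] →ₗ[ℤ] Vec) (p : ℕ → ℤ[X]) (hp : ∀ i, (p i).natDegree ≤ i) (f : F n) :
    V n (fun i => L (p i)) k f = (∏ i ∈ Finset.range k, (p i).coeff i) • V n (fun i => L (X ^ i)) k f := by
  induction k generalizing f with
  | zero => simp [V]
  | succ k ih =>
    rw [V, ih, Finset.prod_range_succ, mul_smul, V]
    congr 1
    have h1 : p k = ∑ i ∈ Finset.range (k + 1), (p k).coeff i • X ^ i := by
      conv_lhs => rw [(p k).as_sum_range' (k + 1) (by have := hp k; omega)]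
      refine Finset.sum_congr rfl fun i _ => ?_
      rw [← C_mul_X_pow_eq_monomial, zsmul_eq_mul]; simp
    have h2 : cr n (L (p k)) f = ∑ i ∈ Finset.range (k + 1), (p k).coeff i • cr n (L (X ^ i)) f := by
      conv_lhs => rw [h1]
      change crL n f _ = _
      rw [map_sum, map_sum]
      refine Finset.sum_congr rfl fun i _ => ?_
      rw [map_smul, map_smul]; rfl
    rw [h2, V_eq_W, ← WL_apply, map_sum, Finset.sum_range_succ, Finset.sum_eq_zero, zero_add, map_smul, WL_apply,
      ← V_eq_W n k (fun i => L (X ^ i))]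
    intro i hi
    rw [map_smul, WL_apply, ← V_eq_W n k (fun i => L (X ^ i)),
      V_rep n k (fun i => L (X ^ i)) i (Finset.mem_range.1 hi), smul_zero]

lemma V_inter (n a : ℕ) : ∃ ε : ℤ, ε * ε = 1 ∧ ∀ (p : ℕ → Vec) (f : F n),
    V n p (2 * a) f = ε • V n (fun i => p (2 * i)) a (V n (fun i => p (2 * i + 1)) a f) := by
  induction a with
  | zero => exact ⟨1, by simp, fun p f => by simp [V]⟩
  | succ a ih =>
    obtain ⟨ε, hε, ih⟩ := ih
    refine ⟨ε * (-1) ^ a, ?_, fun p f => ?_⟩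
    · have : ((-1 : ℤ) ^ a) * (-1) ^ a = 1 := by rw [← mul_pow]; simp
      linear_combination ε * ε * this + hε
    · have : 2 * (a + 1) = 2 * a + 1 + 1 := by ring
      rw [this, V, V, ih, V_comm, V_smul, smul_smul]
      rfl

noncomputable def cf : ℤ[X] →ₗ[ℤ] Vec where
  toFun p := fun i => p.coeff i
  map_add' p q := by funext i; simp
  map_smul' c p := by funext i; simp

lemma cf_apply (p : ℤ[X]) (i : ℕ) : cf p i = p.coeff i := rfl

lemma app_add (k : ℕ) (p q p' q' : Vec) : app k (p + p') (q + q') = app k p q + app k p' q' := by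
  funext i; simp only [app, Pi.add_apply]; split <;> rfl
lemma app_smul (k : ℕ) (c : ℤ) (p q : Vec) : app k (c • p) (c • q) = c • app k p q := by
  funext i; simp only [app, Pi.smul_apply]; split <;> rfl

noncomputable def L (n : ℕ) : ℤ[X] →ₗ[ℤ] Vec where
  toFun p := app n (cf (p.comp (-X))) (cf (p.comp (1 + X)))
  map_add' p q := by rw [add_comp, add_comp, map_add, map_add, app_add]
  map_smul' c p := by
    rw [zsmul_eq_mul, RingHom.id_apply, ← app_smul, ← map_smul, ← map_smul]
    simp

lemma L_apply (n : ℕ) (p : ℤ[X]) : L n p = app n (cf (p.comp (-X))) (cf (p.comp (1 + X))) := rfl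

noncomputable def Om (n : ℕ) : F (n + n) := V (n + n) (fun d => L n (X ^ d)) n (vac _)

noncomputable def Zp (k : ℕ) : ℤ[X] := (X * (1 + X)) ^ k
noncomputable def Vp (k : ℕ) : ℤ[X] := (1 + 2 * X) * (X * (1 + X)) ^ k
noncomputable def Vq : ℕ → ℤ[X]
  | 0 => 1 + 2 * X
  | l + 1 => (1 + 2 * X) * (X * (1 + X) - 2) * (X * (1 + X)) ^ l

noncomputable def up (k : ℕ) : ℤ[X] := (X * (X - 1)) ^ k
noncomputable def vp (k : ℕ) : ℤ[X] := (2 * X - 1) * (X * (X - 1)) ^ k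
noncomputable def vq : ℕ → ℤ[X]
  | 0 => 2 * X - 1
  | l + 1 => (2 * X - 1) * ((X * (X - 1) - 2) * (X * (X - 1)) ^ l)

lemma L_up (n k : ℕ) : L n (up k) = app n (cf (Zp k)) (cf (Zp k)) := by
  rw [L_apply]; congr 2 <;> simp [up, Zp] <;> congr 1 <;> ring
lemma L_vp (n k : ℕ) : L n (vp k) = app n (-cf (Vp k)) (cf (Vp k)) := by
  have h1 : (vp k).comp (-X) = - Vp k := by
    simp [vp, Vp, show -X * (-X - 1) = (X * (1 + X) : ℤ[X]) by ring]; ring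
  have h2 : (vp k).comp (1 + X) = Vp k := by
    simp only [vp, Vp, mul_comp, sub_comp, pow_comp, X_comp, one_comp, ofNat_comp]
    rw [show (1 + X) * (1 + X - 1) = (X * (1 + X) : ℤ[X]) by ring]; ring
  rw [L_apply, h1, h2, map_neg]
lemma L_vq (n k : ℕ) : L n (vq k) = app n (-cf (Vq k)) (cf (Vq k)) := by
  have h1 : (vq k).comp (-X) = - Vq k := by
    cases k
    · simp [vq, Vq]; ring
    · simp [vq, Vq, show -X * (-X - 1) = (X * (1 + X) : ℤ[X]) by ring]; ring
  have h2 : (vq k).comp (1 + X) = Vq k := by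
    cases k
    · simp [vq, Vq]; ring
    · simp [vq, Vq, show (1 + X) * X = (X * (1 + X) : ℤ[X]) by ring]; ring
  rw [L_apply, h1, h2, map_neg]

lemma mon_q : (X * (X - 1) : ℤ[X]).Monic ∧ (X * (X - 1) : ℤ[X]).natDegree = 2 := by
  have h : (X * (X - 1) : ℤ[X]) = X * (X - C 1) := by simp
  rw [h]
  refine ⟨monic_X.mul (monic_X_sub_C 1), ?_⟩
  rw [monic_X.natDegree_mul (monic_X_sub_C 1), natDegree_X, natDegree_X_sub_C]

lemma mon_q2 : (X * (X - 1) - 2 : ℤ[X]).Monic ∧ (X * (X - 1) - 2 : ℤ[X]).natDegree = 2 := by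
  have h : (X * (X - 1) - 2 : ℤ[X]) = (X - C 2) * (X - C (-1)) := by simp; ring
  rw [h]
  refine ⟨(monic_X_sub_C _).mul (monic_X_sub_C _), ?_⟩
  rw [(monic_X_sub_C _).natDegree_mul (monic_X_sub_C _), natDegree_X_sub_C, natDegree_X_sub_C]

lemma up_deg (k : ℕ) : (up k).Monic ∧ (up k).natDegree = 2 * k := by
  refine ⟨mon_q.1.pow k, ?_⟩
  rw [up, mon_q.1.natDegree_pow, mon_q.2, mul_comm]

lemma odd_deg (k : ℕ) (M : ℤ[X]) (h : M.Monic) (hd : M.natDegree = 2 * k) :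
    ((2 * X - 1) * M).natDegree ≤ 2 * k + 1 ∧ ((2 * X - 1) * M).coeff (2 * k + 1) = 2 := by
  constructor
  · refine natDegree_mul_le.trans ?_
    have : (2 * X - 1 : ℤ[X]).natDegree ≤ 1 := by compute_degree
    omega
  · have : ((2 * X - 1) * M) = X * (C 2 * M) - M := by simp; ring
    rw [this, coeff_sub, coeff_X_mul, coeff_C_mul, ← hd, h.coeff_natDegree,
      coeff_eq_zero_of_natDegree_lt (by omega)]
    simp

lemma vp_deg (k : ℕ) : (vp k).natDegree ≤ 2 * k + 1 ∧ (vp k).coeff (2 * k + 1) = 2 :=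
  odd_deg k _ (up_deg k).1 (up_deg k).2

lemma vq_deg (k : ℕ) : (vq k).natDegree ≤ 2 * k + 1 ∧ (vq k).coeff (2 * k + 1) = 2 := by
  cases k with
  | zero => have := odd_deg 0 1 monic_one (by simp); simpa [vq] using this
  | succ l =>
    refine odd_deg (l + 1) _ (mon_q2.1.mul (up_deg l).1) ?_
    have := mon_q2.1.natDegree_mul (up_deg l).1
    rw [mon_q2.2, (up_deg l).2] at this
    rw [up] at this
    rw [this]; ring

noncomputable def inter (u v : ℕ → ℤ[X]) (i : ℕ) : ℤ[X] := if i % 2 = 0 then u (i / 2) else v (i / 2)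

lemma inter_even (u v : ℕ → ℤ[X]) (i : ℕ) : inter u v (2 * i) = u i := by
  simp [inter]
lemma inter_odd (u v : ℕ → ℤ[X]) (i : ℕ) : inter u v (2 * i + 1) = v i := by
  have : (2 * i + 1) / 2 = i := by omega
  simp [inter, this]

lemma prod_inter (u v : ℕ → ℤ[X]) (hu : ∀ k, (u k).coeff (2 * k) = 1)
    (hv : ∀ k, (v k).coeff (2 * k + 1) = 2) (a : ℕ) :
    ∏ i ∈ Finset.range (2 * a), (inter u v i).coeff i = 2 ^ a := by
  induction a with
  | zero => simp
  | succ a ih =>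
    rw [show 2 * (a + 1) = 2 * a + 1 + 1 by ring, Finset.prod_range_succ, Finset.prod_range_succ, ih,
      inter_even, inter_odd, hu, hv, pow_succ]; ring

lemma Om_eq (a : ℕ) : ∃ ε : ℤ, ε * ε = 1 ∧ ∀ v : ℕ → ℤ[X],
    (∀ k, (v k).natDegree ≤ 2 * k + 1 ∧ (v k).coeff (2 * k + 1) = 2) →
    (2 ^ a : ℤ) • Om (2 * a) = ε • W (2 * a + 2 * a) a (fun i => L (2 * a) (up i))
      (W (2 * a + 2 * a) a (fun i => L (2 * a) (v i)) (vac _)) := by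
  obtain ⟨ε, hε, h⟩ := V_inter (2 * a + 2 * a) a
  refine ⟨ε, hε, fun v hv => ?_⟩
  have hu : ∀ k, (up k).coeff (2 * k) = 1 := fun k => by
    rw [← (up_deg k).2, (up_deg k).1.coeff_natDegree]
  have h1 := V_tri (2 * a + 2 * a) (2 * a) (L (2 * a)) (inter up v) (fun i => by
    rcases Nat.even_or_odd' i with ⟨k, rfl | rfl⟩
    · rw [inter_even, (up_deg k).2]
    · rw [inter_odd]; exact (hv k).1) (vac _)
  rw [prod_inter up v hu (fun k => (hv k).2)] at h1
  rw [Om, ← h1, h]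
  simp only [inter_even, inter_odd]
  rw [V_eq_W, V_eq_W]

noncomputable def Gz (n a : ℕ) : ℤ := Matrix.det (Matrix.of fun i j : Fin a => ip n (cf (Zp i)) (cf (Zp j)))
noncomputable def Gv (n a : ℕ) : ℤ := Matrix.det (Matrix.of fun i j : Fin a => ip n (cf (Vp i)) (cf (Vp j)))

lemma det_two {a : ℕ} (f : Fin a → Fin a → ℤ) :
    Matrix.det (Matrix.of fun i j => 2 * f i j) = 2 ^ a * Matrix.det (Matrix.of f) := by
  have : (Matrix.of fun i j => 2 * f i j) = (2 : ℤ) • Matrix.of f := by ext; simp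
  rw [this, Matrix.det_smul]; simp

lemma Gv_nonneg (n a : ℕ) : 0 ≤ Gv n a := by
  have := gram n a (fun i => cf (Vp i)) (fun i => cf (Vp i)) (vac n) (vac n) (fun i => an_vac _ _)
  rw [ipF_vac, mul_one] at this
  rw [Gv, ← this]
  exact ipF_self_nonneg _

theorem norm_Om (a : ℕ) : ipF (Om (2 * a)) (Om (2 * a)) = Gz (2 * a) a * Gv (2 * a) a := by
  obtain ⟨ε, hε, h⟩ := Om_eq a
  have h := h vp vp_deg
  have h2 : ipF ((2 ^ a : ℤ) • Om (2 * a)) ((2 ^ a : ℤ) • Om (2 * a)) =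
      (2 ^ a * Gz (2 * a) a) * (2 ^ a * Gv (2 * a) a) := by
    rw [h, ipF_smul_left, ipF_smul_right, ← mul_assoc, hε, one_mul, gram, gram, ipF_vac, mul_one]
    · simp only [L_up, L_vp, ip_app, ip_neg_left, ip_neg_right, neg_neg]
      simp only [← two_mul (ip _ _ _)]
      rw [det_two, det_two]; rfl
    · intro i; exact an_vac _ _
    · intro i
      refine an_W_zero _ _ _ _ _ (an_vac _ _) fun j => ?_
      rw [L_up, L_vp, ip_app, ip_neg_right]; ring
  rw [ipF_smul_left, ipF_smul_right] at h2
  have : (2 : ℤ) ^ a ≠ 0 := by positivity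
  apply mul_left_cancel₀ this
  apply mul_left_cancel₀ this
  linear_combination h2

lemma cf_X_mul (g : ℤ[X]) : cf (X * g) = sh 0 (cf g) := by
  funext i; cases i <;> simp [cf_apply, sh]
lemma tl_cf_X_mul (g : ℤ[X]) : tl (cf (X * g)) = cf g := by
  funext i; simp [cf_apply, tl]

lemma cf_zero_of (p : ℤ[X]) (d : ℕ) (h : p.natDegree ≤ d) (i : ℕ) (hi : d < i) : cf p i = 0 :=
  coeff_eq_zero_of_natDegree_lt (by omega)

lemma Zp_deg (k : ℕ) : (Zp k).natDegree ≤ 2 * k := by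
  refine natDegree_pow_le.trans ?_
  have : (X * (1 + X) : ℤ[X]).natDegree ≤ 2 := by compute_degree
  nlinarith

lemma Vp_eq (k : ℕ) : cf (Vp k) = cf (Zp k) + 2 • sh 0 (cf (Zp k)) := by
  rw [← cf_X_mul, ← map_nsmul, ← map_add, Vp, Zp]
  congr 1; simp; ring

lemma BB_eq (a k l : ℕ) (hl : l < a) :
    BB (2 * a) (cf (Zp k)) (cf (Vq l)) = ip (2 * a) (cf (Vp k)) (cf (Vp l)) := by
  rw [Vp_eq k]
  cases l with
  | zero =>
    have hg := BB_tele (2 * a) (cf (Zp k)) (cf (C 2)) 3 (fun i hi => by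
      refine cf_zero_of _ 0 (by simp) i (by omega))
    have hh := ip_E (2 * a) (cf (Zp k)) (cf (Vp 0)) 0 (fun i hi => by
      refine cf_zero_of _ 1 ?_ i (by omega)
      simp only [Vp, pow_zero, mul_one]; compute_degree)
    rw [hh]
    have e1 : cf (Vq 0) = sh 3 (cf (C 2)) - cf (C 2) := by
      funext i; rcases i with _ | _ | i <;> simp [cf_apply, sh, Vq, coeff_one, coeff_X, coeff_C]
    have e2 : cf (Vp 0) + 2 • tl (cf (Vp 0)) = sh 3 (cf (C 2)) + cf (C 2) := by
      funext i; rcases i with _ | _ | i <;> simp [cf_apply, sh, Vp, tl, coeff_one, coeff_X, coeff_C]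
    rw [e1, hg, e2]; ring
  | succ l =>
    have hd : (X + 2 : ℤ[X]).natDegree ≤ 1 := by compute_degree
    have hd2 : (1 + 2 * X : ℤ[X]).natDegree ≤ 1 := by compute_degree
    have hg := BB_tele (2 * a) (cf (Zp k)) (cf ((X + 2) * (1 + 2 * X) * Zp l)) 0 (fun i hi => by
      refine cf_zero_of _ (2 * l + 2) ?_ i (by omega)
      have h1 := natDegree_mul_le (p := (X + 2) * (1 + 2 * X)) (q := Zp l)
      have h2 := natDegree_mul_le (p := (X + 2 : ℤ[X])) (q := (1 + 2 * X))
      have := Zp_deg l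
      omega)
    have hh := ip_E (2 * a) (cf (Zp k)) (cf (Vp (l + 1))) 0 (fun i hi => by
      refine cf_zero_of _ (2 * l + 3) ?_ i (by omega)
      have h1 := natDegree_mul_le (p := (1 + 2 * X : ℤ[X])) (q := Zp (l + 1))
      have := Zp_deg (l + 1)
      rw [Zp] at this h1
      rw [Vp]
      omega)
    rw [hh]
    rw [← cf_X_mul, ← map_sub, ← map_add] at hg
    have e1 : Vq (l + 1) = X * ((X + 2) * (1 + 2 * X) * Zp l) - (X + 2) * (1 + 2 * X) * Zp l := by
      rw [Vq, Zp]; ring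
    have e2 : Vp (l + 1) = X * ((1 + 2 * X) * (1 + X) * Zp l) := by rw [Vp, Zp]; ring
    rw [e1, hg]
    rw [e2, tl_cf_X_mul, ← map_nsmul, ← map_add, mul_zero, zero_mul, add_zero]
    congr 2; simp; ring

theorem Ph_Om (a : ℕ) : ∃ ε : ℤ, ε * ε = 1 ∧
    Ph (2 * a + 2 * a) (app (2 * a) (-one) one) (Om (2 * a)) = ε * Gv (2 * a) a := by
  obtain ⟨ε, hε, h⟩ := Om_eq a
  have h := h vq vq_deg
  obtain ⟨ε', hε', h'⟩ := pf_det (2 * a + 2 * a) (app (2 * a) (-one) one) (fun i => by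
    simp only [app]; split <;> simp [one]) a
  have h' := h' (fun i => L (2 * a) (up i)) (fun i => L (2 * a) (vq i)) (fun i j => by
    change QQ _ _ _ _ = 0
    rw [L_up, L_up, QQ_app]; ring)
  refine ⟨ε * ε', by linear_combination ε' * ε' * hε + hε', ?_⟩
  have h3 := congrArg (Ph (2 * a + 2 * a) (app (2 * a) (-one) one)) h
  rw [map_smul, map_smul, h'] at h3
  have h4 : (Matrix.of fun i j : Fin a => ip (2 * a + 2 * a)
      (xi (2 * a + 2 * a) (app (2 * a) (-one) one) (L (2 * a) (up i))) (L (2 * a) (vq j))) =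
      Matrix.of fun i j : Fin a => 2 * ip (2 * a) (cf (Vp i)) (cf (Vp j)) := by
    ext i j
    simp only [Matrix.of_apply]
    change QQ _ _ _ _ = _
    rw [← BB_eq a i j j.2, L_up, L_vq, QQ_app, BB]
    have : QQ (2 * a) one (cf (Zp i)) (-cf (Vq j)) = - QQ (2 * a) one (cf (Zp i)) (cf (Vq j)) := by
      rw [QQ, ip_neg_right]; rfl
    rw [this, ip_neg_right]; ring
  rw [h4, det_two] at h3
  have : (2 : ℤ) ^ a ≠ 0 := by positivity
  apply mul_left_cancel₀ this
  simp only [smul_eq_mul] at h3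
  rw [h3, Gv]; ring

end PP

namespace PP
open Polynomial

/-- transfer operators -/
def G : (n : ℕ) → Bool → (F n →ₗ[ℤ] F n)
  | 0, b => if b then 0 else LinearMap.id
  | n + 1, b => if b then mk 0 ((G n false).comp e0 + (G n true).comp e1)
      else mk ((G n false).comp e0 + (G n true).comp e1) ((G n false).comp e1)

@[simp] lemma e0_G_false (n : ℕ) (f : F (n + 1)) :
    e0 (G (n + 1) false f) = G n false (e0 f) + G n true (e1 f) := by simp [G]
@[simp] lemma e1_G_false (n : ℕ) (f : F (n + 1)) :
    e1 (G (n + 1) false f) = G n false (e1 f) := by simp [G]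
@[simp] lemma e0_G_true (n : ℕ) (f : F (n + 1)) :
    e0 (G (n + 1) true f) = 0 := by simp [G]
@[simp] lemma e1_G_true (n : ℕ) (f : F (n + 1)) :
    e1 (G (n + 1) true f) = G n false (e0 f) + G n true (e1 f) := by simp [G]

def dl (d : ℕ) : Vec := fun i => if i = d then 1 else 0
lemma tl_dl_zero : tl (dl 0) = 0 := by funext i; simp [tl, dl]
lemma tl_dl_succ (d : ℕ) : tl (dl (d + 1)) = dl d := by funext i; simp [tl, dl]

lemma cr_zero (n : ℕ) (f : F n) : cr n 0 f = 0 := by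
  have := cr_smul n 0 0 f
  rwa [zero_smul, zero_smul] at this

lemma G_true (n : ℕ) (f : F n) : G n true f = cr n (dl 0) (G n false f) := by
  cases n with
  | zero => simp [G, cr]
  | succ n =>
    apply F_ext
    · simp [-zsmul_eq_mul, tl_dl_zero, cr_zero]
    · simp [-zsmul_eq_mul, tl_dl_zero, cr_zero, dl]

lemma G_cr (n : ℕ) (w : Vec) (f : F n) : G n false (cr n w f) = cr n (w + sh 0 w) (G n false f) := by
  induction n generalizing w with
  | zero => simp [cr]
  | succ n ih =>
    have ht : tl (w + sh 0 w) = (tl w + sh 0 (tl w)) + w 0 • dl 0 := by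
      funext i; rcases i with _ | i <;> simp [tl, sh, dl]
    have h0 : (w + sh 0 w) 0 = w 0 := by simp [sh]
    apply F_ext
    · rw [e0_G_false, e0_cr, e1_cr, e0_cr, ht, cr_add, cr_smul, map_sub, map_smul, ih, e0_G_false,
        map_add, map_add, G_true n (cr _ _ _), ih, cr_anti, ← G_true, ← G_true, G_true n (e1 f), cr_sq]
      simp [-zsmul_eq_mul]; abel
    · rw [e1_G_false, e1_cr, e1_cr, ht, cr_add, cr_smul, map_sub, map_smul, ih, h0, e0_G_false, e1_G_false,
        ← G_true, smul_add]; abel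

lemma G_vac (n : ℕ) : G n false (vac n) = vac n := by
  induction n with
  | zero => simp [G]
  | succ n ih => apply F_ext <;> simp [ih]

/-- lifted transfer operator acting on the tail modes -/
def Gl (n : ℕ) : (k : ℕ) → (F (n + k) →ₗ[ℤ] F (n + k))
  | 0 => G n false
  | k + 1 => mk ((Gl n k).comp e0) ((Gl n k).comp e1)

@[simp] lemma e0_Gl (n k : ℕ) (f : F (n + k + 1)) : e0 (Gl n (k + 1) f) = Gl n k (e0 f) := by
  simp [Gl]
@[simp] lemma e1_Gl (n k : ℕ) (f : F (n + k + 1)) : e1 (Gl n (k + 1) f) = Gl n k (e1 f) := by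
  simp [Gl]

lemma e0_cr' (n k : ℕ) (w : Vec) (f : F (n + (k + 1))) :
    e0 (n := n + k) (cr (n + (k + 1)) w f) = cr (n + k) (tl w) (e0 (n := n + k) f) := e0_cr (n + k) w f
lemma e1_cr' (n k : ℕ) (w : Vec) (f : F (n + (k + 1))) :
    e1 (n := n + k) (cr (n + (k + 1)) w f) = w 0 • e0 (n := n + k) f - cr (n + k) (tl w) (e1 (n := n + k) f) :=
  e1_cr (n + k) w f
lemma e0_Gl' (n k : ℕ) (f : F (n + (k + 1))) :
    e0 (n := n + k) (Gl n (k + 1) f) = Gl n k (e0 (n := n + k) f) := e0_Gl n k f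
lemma e1_Gl' (n k : ℕ) (f : F (n + (k + 1))) :
    e1 (n := n + k) (Gl n (k + 1) f) = Gl n k (e1 (n := n + k) f) := e1_Gl n k f
lemma e0_vac' (n k : ℕ) : e0 (n := n + k) (vac (n + (k + 1))) = vac (n + k) := e0_vac (n + k)
lemma e1_vac' (n k : ℕ) : e1 (n := n + k) (vac (n + (k + 1))) = 0 := e1_vac (n + k)

lemma Gl_cr (n k : ℕ) (p q : Vec) (f : F (n + k)) :
    Gl n k (cr (n + k) (app k p q) f) = cr (n + k) (app k p (q + sh 0 q)) (Gl n k f) := by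
  induction k generalizing p with
  | zero => simp only [app_zero]; exact G_cr n q f
  | succ k ih =>
    apply F_ext (n := n + k)
    · rw [e0_Gl', e0_cr', e0_cr', tl_app, tl_app, ih, e0_Gl']
    · rw [e1_Gl', e1_cr', e1_cr', tl_app, tl_app, map_sub, ih, e1_Gl', map_smul, e0_Gl', app_succ_zero,
        app_succ_zero]

lemma Gl_vac (n k : ℕ) : Gl n k (vac (n + k)) = vac (n + k) := by
  induction k with
  | zero => exact G_vac n
  | succ k ih =>
    apply F_ext (n := n + k)
    · rw [e0_Gl', e0_vac', ih]
    · rw [e1_Gl', e1_vac', map_zero]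

/-- slice -/
def sl (n : ℕ) : (k : ℕ) → (Fin k → Bool) → (F (n + k) →ₗ[ℤ] F n)
  | 0, _ => LinearMap.id
  | k + 1, s => (sl n k (Fin.tail s)).comp (if s 0 then e1 else e0)

lemma sl_succ (n k : ℕ) (s : Fin (k + 1) → Bool) (f : F (n + k + 1)) :
    sl n (k + 1) s f = sl n k (Fin.tail s) (if s 0 then e1 f else e0 f) := by
  simp only [sl]; cases s 0 <;> rfl

lemma sl_Gl (n k : ℕ) (s : Fin k → Bool) (f : F (n + k)) :
    sl n k s (Gl n k f) = G n false (sl n k s f) := by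
  induction k with
  | zero => rfl
  | succ k ih =>
    rw [sl_succ, sl_succ, ← ih]
    cases s 0
    · simp only [Bool.false_eq_true, if_false, e0_Gl']
    · simp only [if_true, e1_Gl']

def cnt : (k : ℕ) → (Fin k → Bool) → ℕ
  | 0, _ => 0
  | k + 1, s => cnt k (Fin.tail s) + if s 0 then 1 else 0

lemma sl_cr (n k : ℕ) (s : Fin k → Bool) (q : Vec) (f : F (n + k)) :
    sl n k s (cr (n + k) (app k 0 q) f) = (-1 : ℤ) ^ cnt k s • cr n q (sl n k s f) := by
  induction k with
  | zero => simp only [app_zero, sl, cnt]; simp [-zsmul_eq_mul]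
  | succ k ih =>
    rw [sl_succ, sl_succ, cnt]
    have h := ih (Fin.tail s)
    cases h0 : s 0
    · simp only [Bool.false_eq_true, if_false, add_zero]
      rw [← h, e0_cr', tl_app, tl_zero]
    · simp only [if_true]
      rw [pow_succ, mul_neg_one, neg_smul, ← h, e1_cr', tl_app, tl_zero, app_succ_zero]
      simp [-zsmul_eq_mul]

lemma V_e0 (n k : ℕ) (u : ℕ → Vec) (f : F (n + 1)) :
    e0 (V (n + 1) u k f) = V n (fun d => tl (u d)) k (e0 f) := by
  induction k generalizing f with
  | zero => rfl
  | succ k ih => rw [V, ih, e0_cr, V]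

lemma V_e1 (n k : ℕ) (u : ℕ → Vec) (f : F (n + 1)) (hf : e1 f = 0) (hu : ∀ d, u d 0 = 0) :
    e1 (V (n + 1) u k f) = 0 := by
  induction k generalizing f with
  | zero => exact hf
  | succ k ih => rw [V, ih]; simp [hu, hf]

noncomputable def Omk (n k : ℕ) (y : ℕ → ℤ) : F (n + k) :=
  V (n + k) (fun d => app k (y d • dl d) (cf ((1 + X) ^ d))) k (vac _)

lemma Om_eq_Omk (n : ℕ) : Om n = Omk n n (fun d => (-1) ^ d) := by
  rw [Om, Omk]
  congr 1
  funext d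
  rw [L_apply]
  congr 1
  · funext i
    have : (X ^ d : ℤ[X]).comp (-X) = C ((-1) ^ d) * X ^ d := by
      rw [pow_comp, X_comp, neg_pow (X : ℤ[X]) d]; simp
    rw [this, cf_apply, coeff_C_mul, coeff_X_pow]
    simp [dl]
  · simp

lemma Gl_V (n k m : ℕ) (y : ℕ → ℤ) (f : F (n + k)) :
    Gl n k (V (n + k) (fun d => app k (y d • dl d) (cf ((1 + X) ^ d))) m f) =
      V (n + k) (fun d => app k (y d • dl d) (cf ((1 + X) ^ (d + 1)))) m (Gl n k f) := by
  induction m generalizing f with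
  | zero => rfl
  | succ m ih =>
    rw [V, ih, Gl_cr, V]
    congr 3
    rw [← cf_X_mul, ← map_add]; congr 1; ring

lemma Omk_succ (n k : ℕ) (y : ℕ → ℤ) :
    e1 (Omk n (k + 1) y) = y 0 • Gl n k (Omk n k (tl y)) ∧
    e0 (Omk n (k + 1) y) = cr (n + k) (app k 0 (dl 0)) (Gl n k (Omk n k (tl y))) := by
  have hP := V_e0 (n + k) k (fun d => app (k + 1) (y (d + 1) • dl (d + 1)) (cf ((1 + X) ^ (d + 1)))) (vac _)
  have hQ := V_e1 (n + k) k (fun d => app (k + 1) (y (d + 1) • dl (d + 1)) (cf ((1 + X) ^ (d + 1)))) (vac _)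
    (by simp) (by intro d; rw [app_succ_zero]; simp [dl])
  have hR : Gl n k (Omk n k (tl y)) = V (n + k)
      (fun d => tl (app (k + 1) (y (d + 1) • dl (d + 1)) (cf ((1 + X) ^ (d + 1))))) k (vac _) := by
    rw [Omk, Gl_V, Gl_vac]
    congr 1
    funext d
    rw [tl_app, tl_smul, tl_dl_succ]; rfl
  rw [e0_vac, ← hR] at hP
  have hO : Omk n (k + 1) y = cr (n + k + 1) (app (k + 1) (y 0 • dl 0) (cf ((1 + X) ^ 0)))
    (V (n + k + 1) (fun d => app (k + 1) (y (d + 1) • dl (d + 1)) (cf ((1 + X) ^ (d + 1)))) k (vac _)) :=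
    V_succ_left (n + k + 1) k _ _
  have : cf ((1 + X) ^ 0) = dl 0 := by
    funext i; simp [cf_apply, dl, coeff_one]
  rw [hO]
  refine ⟨(e1_cr (n + k) _ _).trans ?_, (e0_cr (n + k) _ _).trans ?_⟩
  · rw [hP, hQ, app_succ_zero]
    simp [dl, -zsmul_eq_mul]
  · rw [hP, tl_app, tl_smul, tl_dl_zero, smul_zero, this]

def NN (n : ℕ) : (k : ℕ) → (Fin k → Bool) → F n
  | 0, _ => vac n
  | k + 1, s => G n (!(s 0)) (NN n k (Fin.tail s))

def co : (k : ℕ) → (Fin k → Bool) → (ℕ → ℤ) → ℤ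
  | 0, _, _ => 1
  | k + 1, s, y => if s 0 then y 0 * co k (Fin.tail s) (tl y) else (-1) ^ cnt k (Fin.tail s) * co k (Fin.tail s) (tl y)

lemma sl_Omk (n k : ℕ) (s : Fin k → Bool) (y : ℕ → ℤ) : sl n k s (Omk n k y) = co k s y • NN n k s := by
  induction k generalizing y with
  | zero => simp [sl, Omk, V, co, NN]
  | succ k ih =>
    have hs : sl n (k + 1) s (Omk n (k + 1) y) = _ := sl_succ n k s _
    rw [hs, (Omk_succ n k y).1, (Omk_succ n k y).2, co, NN]
    cases s 0
    · simp only [Bool.false_eq_true, if_false, Bool.not_false]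
      rw [sl_cr, sl_Gl, ih, G_true, map_smul, map_smul, smul_smul]
    · simp only [if_true, Bool.not_true]
      rw [map_smul, sl_Gl, ih, map_smul, smul_smul]

lemma sum_cons {k : ℕ} (f : (Fin (k + 1) → Bool) → ℤ) :
    ∑ s, f s = ∑ s, f (Fin.cons false s) + ∑ s, f (Fin.cons true s) := sum_split f

lemma ipF_sl (n k : ℕ) (f g : F (n + k)) : ipF f g = ∑ s, ipF (sl n k s f) (sl n k s g) := by
  induction k with
  | zero => simp [sl]
  | succ k ih =>
    have : ipF f g = ipF (n := n + k) (e0 f) (e0 g) + ipF (n := n + k) (e1 f) (e1 g) := ipF_succ _ _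
    rw [this, ih, ih, sum_cons]
    congr 1

lemma co_sq (k : ℕ) (s : Fin k → Bool) (y : ℕ → ℤ) (hy : ∀ i, y i * y i = 1) : co k s y * co k s y = 1 := by
  induction k generalizing y with
  | zero => simp [co]
  | succ k ih =>
    have h := ih (Fin.tail s) (tl y) (fun i => hy _)
    rw [co]
    split
    · linear_combination (co k (Fin.tail s) (tl y)) ^ 2 * hy 0 + h
    · have : ((-1 : ℤ) ^ cnt k (Fin.tail s)) * (-1) ^ cnt k (Fin.tail s) = 1 := by rw [← mul_pow]; simp
      linear_combination (co k (Fin.tail s) (tl y)) ^ 2 * this + h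

theorem norm_Om_sum (n : ℕ) : ipF (Om n) (Om n) = ∑ s, ∑ t, NN n n s t * NN n n s t := by
  rw [Om_eq_Omk, ipF_sl]
  refine Finset.sum_congr rfl fun s _ => ?_
  rw [sl_Omk, ipF_smul_left, ipF_smul_right, ← mul_assoc, co_sq, one_mul]; rfl
  intro i
  rw [← mul_pow]; simp

def ww : (k : ℕ) → (Fin k → Bool) → ℤ → ℤ
  | 0, _, _ => 1
  | k + 1, s, σ => if s 0 then σ * ww k (Fin.tail s) (-σ) else ww k (Fin.tail s) σ

lemma Ph_one (n : ℕ) (f : F n) : Ph n one f = ∑ t, f t := by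
  induction n with
  | zero =>
    simp only [Ph, LinearMap.proj_apply]
    rw [Fintype.sum_unique]; congr 1
  | succ n ih => rw [Ph_succ, sum_split, tl_one, ih, ih]; simp [one]

lemma Ph_sl (n k : ℕ) (f : F (n + k)) (σ : ℤ) (hf : ch (n + k) f = σ • f) :
    Ph (n + k) (app k (-one) one) f = ∑ s, ww k s σ * ∑ t, sl n k s f t := by
  induction k generalizing σ with
  | zero => rw [app_zero]; simp [sl, ww, Ph_one]
  | succ k ih =>
    have h := Ph_succ (n + k) (app (k + 1) (-one) one) f
    have h0 : ch (n + k) (e0 f) = σ • e0 f := by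
      rw [← map_smul, ← hf]; exact (e0_ch (n + k) f).symm
    have h1 : ch (n + k) (e1 f) = (-σ) • e1 f := by
      rw [neg_smul, ← map_smul, ← hf]
      have := e1_ch (n + k) f
      exact neg_eq_iff_eq_neg.mp this.symm
    rw [tl_app, tl_neg_one, app_succ_zero, h1, map_smul, ih _ _ h0, ih _ _ h1] at h
    refine h.trans ?_
    rw [sum_cons]
    congr 1
    simp only [Pi.neg_apply, one]
    simp only [smul_eq_mul, Finset.mul_sum]
    norm_num
    refine Finset.sum_congr rfl fun s _ => ?_
    refine Finset.sum_congr rfl fun t _ => ?_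
    simp [ww, sl_succ, mul_assoc]

lemma ww_co (k : ℕ) (s : Fin k → Bool) (σ τ : ℤ) (y : ℕ → ℤ) (hy : ∀ d, y d = τ * (-1) ^ d) :
    ww k s σ * co k s y = (σ * τ) ^ cnt k s := by
  induction k generalizing σ τ y with
  | zero => simp [ww, co, cnt]
  | succ k ih =>
    have hy' : ∀ d, tl y d = (-τ) * (-1) ^ d := fun d => by
      simp only [tl, hy, pow_succ]; ring
    rw [ww, co, cnt]
    split
    · have := ih (Fin.tail s) (-σ) (-τ) (tl y) hy'
      rw [neg_mul_neg] at this
      rw [pow_succ, ← this, hy 0]; ring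
    · have := ih (Fin.tail s) σ (-τ) (tl y) hy'
      rw [mul_left_comm, this, ← mul_pow, add_zero]; congr 1; ring

theorem Ph_Om_sum (n : ℕ) (hn : Even n) :
    Ph (n + n) (app n (-one) one) (Om n) = ∑ s, ∑ t, NN n n s t := by
  rw [Om_eq_Omk, Ph_sl n n _ 1]
  · refine Finset.sum_congr rfl fun s _ => ?_
    rw [sl_Omk, Finset.mul_sum]
    refine Finset.sum_congr rfl fun t _ => ?_
    have := ww_co n s 1 1 (fun d => (-1) ^ d) (by simp)
    rw [Pi.smul_apply, smul_eq_mul, ← mul_assoc, this]; simp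
  · rw [Omk, V_eq_W, ch_W, hn.neg_one_pow, ch_vac]

/-- states for the self-complementary case -/
noncomputable def Cs (a k : ℕ) : F (a + k) := V (a + k) (fun d => cf (Zp d)) k (vac _)

lemma G_V (n m : ℕ) (f : F n) : G n false (V n (fun d => cf (Zp d)) m f) =
      V n (fun d => cf ((1 + X) * Zp d)) m (G n false f) := by
  induction m generalizing f with
  | zero => rfl
  | succ m ih =>
    rw [V, ih, G_cr, V]
    congr 3
    rw [← cf_X_mul, ← map_add]; congr 1; ring

lemma Cs_zero (a : ℕ) : Cs a 0 = vac a := rfl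

lemma Cs_succ (a k : ℕ) : e0 (Cs a (k + 1)) = 0 ∧ e1 (Cs a (k + 1)) = G (a + k) false (Cs a k) := by
  have hz : ∀ d, Zp (d + 1) = X * ((1 + X) * Zp d) := fun d => by rw [Zp, Zp]; ring
  have hP := V_e0 (a + k) k (fun d => cf (Zp (d + 1))) (vac _)
  have hQ := V_e1 (a + k) k (fun d => cf (Zp (d + 1))) (vac _) (by simp) (by
    intro d; rw [hz, cf_apply]; simp)
  have hO : Cs a (k + 1) = cr (a + k + 1) (cf (Zp 0)) (V (a + k + 1) (fun d => cf (Zp (d + 1))) k (vac _)) :=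
    V_succ_left (a + k + 1) k _ _
  have : cf (Zp 0) = dl 0 := by
    funext i; simp [cf_apply, dl, coeff_one, Zp]
  have hR : e0 (V (a + k + 1) (fun d => cf (Zp (d + 1))) k (vac _)) = G (a + k) false (Cs a k) := by
    rw [hP, e0_vac, Cs, G_V, G_vac]; congr 1; funext d; rw [hz, tl_cf_X_mul]
  rw [hO]
  refine ⟨(e0_cr (a + k) _ _).trans ?_, (e1_cr (a + k) _ _).trans ?_⟩
  · rw [this, tl_dl_zero, cr_zero]
  · rw [hR, hQ, this]
    simp [dl, -zsmul_eq_mul]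

lemma norm_Cs (a : ℕ) : ∑ t, Cs a a t * Cs a a t = Gz (2 * a) a := by
  have : ipF (Cs a a) (Cs a a) = Gz (a + a) a := by
    rw [Cs, V_eq_W, gram _ _ _ _ _ _ (fun i => an_vac _ _), ipF_vac, mul_one]; rfl
  rw [two_mul, ← this]; rfl

theorem main_alg (a : ℕ) (hnn : ∀ s t, 0 ≤ NN (2 * a) (2 * a) s t) :
    ∑ s, ∑ t, NN (2 * a) (2 * a) s t * NN (2 * a) (2 * a) s t =
    (∑ s, ∑ t, NN (2 * a) (2 * a) s t) * ∑ t, Cs a a t * Cs a a t := by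
  have h1 := norm_Om_sum (2 * a)
  have h2 := Ph_Om_sum (2 * a) (even_two_mul a)
  obtain ⟨ε, hε, h3⟩ := Ph_Om a
  have h4 : (0 : ℤ) ≤ ∑ s, ∑ t, NN (2 * a) (2 * a) s t :=
    Finset.sum_nonneg fun s _ => Finset.sum_nonneg fun t _ => hnn s t
  have h5 := Gv_nonneg (2 * a) a
  rw [← h1, norm_Om, norm_Cs]
  rw [h2] at h3
  have h6 : ε = 1 ∨ ε = -1 := mul_self_eq_one_iff.1 hε
  have : (∑ s, ∑ t, NN (2 * a) (2 * a) s t) = Gv (2 * a) a := by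
    rcases h6 with rfl | rfl
    · linarith
    · linarith
  rw [this]; ring

end PP

namespace PP

def hgt : (n : ℕ) → (Fin n → Bool) → ℕ → ℕ
  | 0, _, _ => 0
  | n + 1, t, 0 => (t 0).toNat + hgt n (Fin.tail t) 0
  | n + 1, t, p + 1 => hgt n (Fin.tail t) p

lemma hgt_cons_zero (n : ℕ) (c : Bool) (r : Fin n → Bool) :
    hgt (n + 1) (Fin.cons c r) 0 = c.toNat + hgt n r 0 := by simp [hgt]
lemma hgt_cons_succ (n : ℕ) (c : Bool) (r : Fin n → Bool) (p : ℕ) :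
    hgt (n + 1) (Fin.cons c r) (p + 1) = hgt n r p := by simp [hgt]

lemma hgt_ge (n : ℕ) (t : Fin n → Bool) (p : ℕ) (h : n ≤ p) : hgt n t p = 0 := by
  induction n generalizing p with
  | zero => rfl
  | succ n ih =>
    cases p with
    | zero => omega
    | succ p => exact ih _ _ (by omega)

lemma hgt_step (n : ℕ) (t : Fin n → Bool) (p : ℕ) :
    hgt n t (p + 1) ≤ hgt n t p ∧ hgt n t p ≤ hgt n t (p + 1) + 1 := by
  induction n generalizing p with
  | zero => simp [hgt]
  | succ n ih =>
    cases p with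
    | zero => simp only [hgt]; cases t 0 <;> simp [Bool.toNat]; omega
    | succ p => exact ih _ _

lemma hgt_inj (n : ℕ) (t t' : Fin n → Bool) (h : ∀ p, hgt n t p = hgt n t' p) : t = t' := by
  induction n with
  | zero => funext i; exact i.elim0
  | succ n ih =>
    have h1 : Fin.tail t = Fin.tail t' := ih _ _ (fun p => h (p + 1))
    have h2 := h 0
    simp only [hgt, h1] at h2
    have h3 : t 0 = t' 0 := by
      cases h : t 0 <;> cases h' : t' 0 <;> simp_all
    rw [← Fin.cons_self_tail t, ← Fin.cons_self_tail t', h1, h3]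

lemma exists_bits (n : ℕ) (h : ℕ → ℕ) (h0 : ∀ p, n ≤ p → h p = 0)
    (hs : ∀ p, h (p + 1) ≤ h p ∧ h p ≤ h (p + 1) + 1) : ∃ t : Fin n → Bool, ∀ p, h p = hgt n t p := by
  induction n generalizing h with
  | zero => exact ⟨fun i => i.elim0, fun p => by simp [hgt, h0]⟩
  | succ n ih =>
    obtain ⟨r, hr⟩ := ih (fun p => h (p + 1)) (fun p hp => h0 _ (by omega)) (fun p => hs _)
    refine ⟨Fin.cons (decide (h 0 = h 1 + 1)) r, fun p => ?_⟩
    cases p with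
    | zero =>
      rw [hgt_cons_zero, ← hr]
      have := hs 0
      by_cases hh : h 0 = h 1 + 1
      · simp [hh]; omega
      · simp [hh]; simp at this; omega
    | succ p => rw [hgt_cons_succ, ← hr]

lemma hgt_false (n p : ℕ) : hgt n (fun _ => false) p = 0 := by
  induction n generalizing p with
  | zero => rfl
  | succ n ih => cases p <;> simp only [hgt] <;> simp [Fin.tail_def, ih]

lemma vac_eq (n : ℕ) (t : Fin n → Bool) : vac n t = if t = fun _ => false then 1 else 0 := by
  simp [vac, funext_iff]

def K (n : ℕ) (b : Bool) (t' t : Fin n → Bool) : Prop :=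
  hgt n t 0 = hgt n t' 0 + b.toNat ∧ ∀ p, hgt n t (p + 1) ≤ hgt n t' p ∧ hgt n t' p ≤ hgt n t p

lemma K_cons (n : ℕ) (b c c' : Bool) (r r' : Fin n → Bool) :
    K (n + 1) b (Fin.cons c' r') (Fin.cons c r) ↔
      (c.toNat + hgt n r 0 = c'.toNat + hgt n r' 0 + b.toNat ∧ b.toNat ≤ c.toNat ∧
      ∀ p, hgt n r (p + 1) ≤ hgt n r' p ∧ hgt n r' p ≤ hgt n r p) := by
  simp only [K, hgt_cons_zero]
  constructor
  · rintro ⟨h1, h2⟩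
    refine ⟨h1, ?_, fun p => ?_⟩
    · have := (h2 0).1
      rw [hgt_cons_succ, hgt_cons_zero] at this
      omega
    · have := h2 (p + 1)
      simpa only [hgt_cons_succ] using this
  · rintro ⟨h1, h2, h3⟩
    refine ⟨h1, fun p => ?_⟩
    cases p with
    | zero => simp only [hgt_cons_zero, hgt_cons_succ]; omega
    | succ p => simpa only [hgt_cons_succ] using h3 p

open Classical in
lemma G_kernel (n : ℕ) (b : Bool) (f : F n) (t : Fin n → Bool) :
    G n b f t = ∑ t', if K n b t' t then f t' else 0 := by
  induction n generalizing b with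
  | zero =>
    rw [Fintype.sum_unique]
    have : t = default := Subsingleton.elim _ _
    subst this
    cases b <;> simp [G, K, hgt]
    exact congrArg f (Subsingleton.elim _ _)
  | succ n ih =>
    rw [← Fin.cons_self_tail t]
    generalize Fin.tail t = r
    generalize t 0 = c
    rw [sum_cons]
    have hk : ∀ (b : Bool) (g : F n), ∑ r', (if K n b r' r then g r' else 0) = G n b g r :=
      fun b g => (ih b g r).symm
    have f0 : ∀ r', f (Fin.cons false r') = e0 f r' := fun _ => rfl
    have f1 : ∀ r', f (Fin.cons true r') = e1 f r' := fun _ => rfl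
    have g0 : ∀ b, G (n + 1) b f (Fin.cons false r) = e0 (G (n + 1) b f) r := fun _ => rfl
    have g1 : ∀ b, G (n + 1) b f (Fin.cons true r) = e1 (G (n + 1) b f) r := fun _ => rfl
    simp only [f0, f1]
    cases b <;> cases c
    · rw [g0, e0_G_false, Pi.add_apply, ← hk, ← hk]
      congr 1 <;> refine Finset.sum_congr rfl fun r' _ => ?_ <;> congr 1 <;>
        rw [K_cons, K] <;> simp
      omega
    · rw [g1, e1_G_false, ← hk]
      rw [Finset.sum_eq_zero (s := Finset.univ) (f := fun r' => if K (n + 1) false (Fin.cons false r') (Fin.cons true r) then e0 f r' else 0), zero_add]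
      · refine Finset.sum_congr rfl fun r' _ => ?_
        congr 1; rw [K_cons, K]; simp
      · intro r' _
        rw [if_neg]
        rw [K_cons]; rintro ⟨h1, -, h3⟩
        have := h3 0
        simp at h1; omega
    · rw [g0, e0_G_true]
      have hn : ∀ c' r', ¬ K (n + 1) true (Fin.cons c' r') (Fin.cons false r) := by
        intro c' r'; rw [K_cons]; simp
      simp [hn]
    · rw [g1, e1_G_true, Pi.add_apply, ← hk, ← hk]
      congr 1 <;> refine Finset.sum_congr rfl fun r' _ => ?_ <;> congr 1 <;>
        rw [K_cons, K] <;> simp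
      · omega
      · omega

def consD (h : ℕ → ℕ) (D : ℕ → ℕ → ℕ) : ℕ → ℕ → ℕ
  | 0 => h
  | d + 1 => D d

lemma consD_inj (h : ℕ → ℕ) : Function.Injective (consD h) := by
  intro D D' e
  funext d
  exact congrFun e (d + 1)

open Classical in
noncomputable def FA (n : ℕ) : (k : ℕ) → (Fin k → Bool) → (Fin n → Bool) → Finset (ℕ → ℕ → ℕ)
  | 0, _, t => if t = fun _ => false then {fun _ _ => 0} else ∅
  | k + 1, s, t => (Finset.univ.filter fun t' => K n (!(s 0)) t' t).biUnion
      fun t' => (FA n k (Fin.tail s) t').image (consD (hgt n t))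

lemma FA_row (n k : ℕ) (s : Fin k → Bool) (t : Fin n → Bool) (D : ℕ → ℕ → ℕ) (h : D ∈ FA n k s t) (p : ℕ) :
    D 0 p = hgt n t p := by
  cases k with
  | zero =>
    simp only [FA] at h
    split at h
    · simp at h; subst h; rename_i h; subst h; simp [hgt_false]
    · simp at h
  | succ k =>
    simp only [FA, Finset.mem_biUnion, Finset.mem_image] at h
    obtain ⟨t', _, D', _, rfl⟩ := h
    rfl

lemma FA_card (n k : ℕ) (s : Fin k → Bool) (t : Fin n → Bool) : ((FA n k s t).card : ℤ) = NN n k s t := by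
  classical
  induction k generalizing t with
  | zero => simp only [FA, NN, vac_eq]; split <;> simp
  | succ k ih =>
    rw [FA, NN, G_kernel, Finset.card_biUnion, Finset.sum_filter, Nat.cast_sum]
    · refine Finset.sum_congr rfl fun t' _ => ?_
      split
      · rw [Finset.card_image_of_injective _ (consD_inj _), ih]
      · simp
    · intro t1 _ t2 _ hne
      rw [Function.onFun, Finset.disjoint_left]
      intro D h1 h2
      rw [Finset.mem_image] at h1 h2
      obtain ⟨D1, h1, e1⟩ := h1
      obtain ⟨D2, h2, e2⟩ := h2
      have : D1 = D2 := consD_inj _ (e1.trans e2.symm)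
      subst this
      apply hne
      apply hgt_inj
      intro p
      rw [← FA_row _ _ _ _ _ h1, ← FA_row _ _ _ _ _ h2]

structure Arr (n : ℕ) (k : ℕ) (D : ℕ → ℕ → ℕ) : Prop where
  i : ∀ d p, D (d + 1) p ≤ D d p
  ii : ∀ d p, D d (p + 1) ≤ D (d + 1) p
  iii : ∀ d p, D d p ≤ D d (p + 1) + 1
  iv : ∀ d p, k ≤ d → D d p = 0
  v : ∀ d p, n ≤ p → D d p = 0

lemma hgt_not_zero (k : ℕ) (s : Fin (k + 1) → Bool) :
    hgt (k + 1) (fun i => !(s i)) 0 = (!(s 0)).toNat + hgt k (fun i => !(Fin.tail s i)) 0 := rfl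
lemma hgt_not_succ (k : ℕ) (s : Fin (k + 1) → Bool) (p : ℕ) :
    hgt (k + 1) (fun i => !(s i)) (p + 1) = hgt k (fun i => !(Fin.tail s i)) p := rfl

lemma FA_mem (n k : ℕ) (s : Fin k → Bool) (t : Fin n → Bool) (D : ℕ → ℕ → ℕ) :
    D ∈ FA n k s t ↔ (∀ p, D 0 p = hgt n t p) ∧ (∀ d, D d 0 = hgt k (fun i => !(s i)) d) ∧ Arr n k D := by
  classical
  induction k generalizing t D with
  | zero =>
    simp only [FA]
    constructor
    · intro h
      split at h
      · rename_i ht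
        simp at h; subst h; subst ht
        exact ⟨fun p => by simp [hgt_false], fun d => rfl, by constructor <;> simp⟩
      · simp at h
    · rintro ⟨h1, h2, h3⟩
      have : D = fun _ _ => 0 := by funext d p; exact h3.iv _ _ (by omega)
      rw [if_pos]
      · simp [this]
      · apply hgt_inj; intro p; rw [← h1, hgt_false, this]
  | succ k ih =>
    simp only [FA, Finset.mem_biUnion, Finset.mem_image, Finset.mem_filter, Finset.mem_univ, true_and]
    constructor
    · rintro ⟨t', hK, D', hD', rfl⟩
      obtain ⟨h1, h2, h3⟩ := (ih _ _ _).1 hD'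
      refine ⟨fun p => rfl, fun d => ?_, ?_⟩
      · cases d with
        | zero =>
          rw [hgt_not_zero, ← h2 0, h1 0]
          have := hK.1
          simp only [consD]; omega
        | succ d => exact h2 d
      · constructor
        · rintro (_ | d) p
          · simp only [consD, h1]; exact (hK.2 p).2
          · exact h3.i d p
        · rintro (_ | d) p
          · simp only [consD, h1]; exact (hK.2 p).1
          · exact h3.ii d p
        · rintro (_ | d) p
          · exact (hgt_step n t p).2
          · exact h3.iii d p
        · rintro (_ | d) p h
          · omega
          · exact h3.iv d p (by omega)
        · rintro (_ | d) p h
          · exact hgt_ge n t p h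
          · exact h3.v d p h
    · rintro ⟨h1, h2, h3⟩
      obtain ⟨t', ht'⟩ := exists_bits n (D 1) (fun p hp => h3.v 1 p hp)
        (fun p => ⟨(h3.ii 1 p).trans (h3.i 1 p), h3.iii 1 p⟩)
      refine ⟨t', ⟨?_, fun p => ?_⟩, fun d => D (d + 1), (ih _ _ _).2 ⟨ht', fun d => ?_, ?_⟩, ?_⟩
      · rw [← h1, ← ht', h2, h2, hgt_not_zero, hgt_not_succ]; omega
      · rw [← h1, ← h1, ← ht']; exact ⟨h3.ii 0 p, h3.i 0 p⟩
      · exact h2 (d + 1)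
      · exact ⟨fun d p => h3.i _ _, fun d p => h3.ii _ _, fun d p => h3.iii _ _,
          fun d p h => h3.iv _ _ (by omega), fun d p h => h3.v _ _ h⟩
      · funext d p
        cases d with
        | zero => exact (h1 p).symm
        | succ d => rfl

lemma Arr_exists (n : ℕ) (D : ℕ → ℕ → ℕ) (h : Arr n n D) : ∃ s t, D ∈ FA n n s t := by
  obtain ⟨t, ht⟩ := exists_bits n (D 0) (fun p hp => h.v 0 p hp)
        (fun p => ⟨(h.ii 0 p).trans (h.i 0 p), h.iii 0 p⟩)
  obtain ⟨s, hs⟩ := exists_bits n (fun d => D d 0) (fun p hp => h.iv p 0 hp)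
        (fun p => ⟨h.i p 0, (h.iii p 0).trans (by have := h.ii p 0; omega)⟩)
  refine ⟨fun i => !(s i), t, (FA_mem _ _ _ _ _).2 ⟨ht, fun d => ?_, h⟩⟩
  simp only [Bool.not_not]; exact hs d

lemma FA_unique (n : ℕ) (s s' t t' : Fin n → Bool) (D : ℕ → ℕ → ℕ) (h : D ∈ FA n n s t)
    (h' : D ∈ FA n n s' t') : s = s' ∧ t = t' := by
  obtain ⟨h1, h2, h3⟩ := (FA_mem _ _ _ _ _).1 h
  obtain ⟨h1', h2', h3'⟩ := (FA_mem _ _ _ _ _).1 h'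
  constructor
  · have := hgt_inj n _ _ (fun d => (h2 d).symm.trans (h2' d))
    funext i
    have := congrFun this i
    simpa using this
  · exact hgt_inj n _ _ (fun d => (h1 d).symm.trans (h1' d))

end PP

namespace PP

lemma card_of_rel {α β : Type*} (A : Set α) (B : Set β) (R : α → β → Prop)
    (h1 : ∀ a ∈ A, ∃ b ∈ B, R a b) (h2 : ∀ b ∈ B, ∃ a ∈ A, R a b)
    (u1 : ∀ a ∈ A, ∀ a' ∈ A, ∀ b ∈ B, R a b → R a' b → a = a')
    (u2 : ∀ a ∈ A, ∀ b ∈ B, ∀ b' ∈ B, R a b → R a b' → b = b') : Nat.card A = Nat.card B := by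
  choose f hf hR using h1
  refine Nat.card_congr (Equiv.ofBijective (fun a : A => (⟨f a a.2, hf a a.2⟩ : B)) ⟨?_, ?_⟩)
  · rintro ⟨a, ha⟩ ⟨a', ha'⟩ e
    have e' : f a ha = f a' ha' := congrArg Subtype.val e
    apply Subtype.ext
    exact u1 a ha a' ha' (f a ha) (hf a ha) (hR a ha) (e' ▸ hR a' ha')
  · rintro ⟨b, hb⟩
    obtain ⟨a, ha, hab⟩ := h2 b hb
    exact ⟨⟨a, ha⟩, Subtype.ext (u2 a ha _ (hf a ha) b hb (hR a ha) hab)⟩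

/-- pairs of arrays -/
def PS (n : ℕ) : Set ((ℕ → ℕ → ℕ) × (ℕ → ℕ → ℕ)) :=
  {x | Arr n n x.1 ∧ Arr n n x.2 ∧ (∀ p, x.1 0 p = x.2 0 p) ∧ ∀ d, x.1 d 0 = x.2 d 0}

lemma PS_card (n : ℕ) : (Nat.card (PS n) : ℤ) = ∑ s, ∑ t, NN n n s t * NN n n s t := by
  classical
  have h : PS n = ↑((Finset.univ : Finset ((Fin n → Bool) × (Fin n → Bool))).biUnion
      fun q => FA n n q.1 q.2 ×ˢ FA n n q.1 q.2) := by
    ext ⟨D, D'⟩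
    simp only [PS, Set.mem_ofPred_eq, Finset.coe_biUnion, Set.mem_iUnion, Finset.mem_coe, Finset.mem_product,
      Finset.mem_univ, Prod.exists, exists_prop, true_and]
    constructor
    · rintro ⟨h1, h2, h3, h4⟩
      obtain ⟨s, t, h⟩ := Arr_exists n D h1
      refine ⟨s, t, h, ?_⟩
      rw [FA_mem] at h ⊢
      exact ⟨fun p => (h3 p).symm.trans (h.1 p), fun p => (h4 p).symm.trans (h.2.1 p), h2⟩
    · rintro ⟨s, t, h, h'⟩
      rw [FA_mem] at h h'
      exact ⟨h.2.2, h'.2.2, fun p => (h.1 p).trans (h'.1 p).symm, fun p => (h.2.1 p).trans (h'.2.1 p).symm⟩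
  rw [h, Nat.card_coe_set_eq, Set.ncard_coe_finset, Finset.card_biUnion, Nat.cast_sum, Fintype.sum_prod_type]
  · refine Finset.sum_congr rfl fun s _ => Finset.sum_congr rfl fun t _ => ?_
    rw [Finset.card_product, Nat.cast_mul, FA_card]
  · rintro ⟨s, t⟩ _ ⟨s', t'⟩ _ hne
    rw [Function.onFun, Finset.disjoint_left]
    rintro ⟨D, D'⟩ h h'
    apply hne
    rw [Finset.mem_product] at h h'
    obtain ⟨rfl, rfl⟩ := FA_unique n s s' t t' D h.1 h'.1
    rfl

lemma PT_card (n : ℕ) : (Nat.card ({x | x ∈ PS n ∧ x.1 = x.2} : Set _) : ℤ) = ∑ s, ∑ t, NN n n s t := by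
  classical
  have h : Nat.card ({x | x ∈ PS n ∧ x.1 = x.2} : Set _) =
      Nat.card (↑((Finset.univ : Finset ((Fin n → Bool) × (Fin n → Bool))).biUnion
      fun q => FA n n q.1 q.2) : Set (ℕ → ℕ → ℕ)) := by
    refine card_of_rel _ _ (fun x D => x.1 = D) ?_ ?_ ?_ ?_
    · rintro ⟨D, D'⟩ ⟨h, (e : D = D')⟩
      subst e
      obtain ⟨s, t, h⟩ := Arr_exists n D h.1
      exact ⟨D, by simp only [Finset.coe_biUnion, Set.mem_iUnion, Finset.mem_coe]; exact ⟨(s, t), Finset.mem_univ _, h⟩, rfl⟩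
    · intro D h
      simp only [Finset.coe_biUnion, Set.mem_iUnion, Finset.mem_coe] at h
      obtain ⟨q, _, h⟩ := h
      rw [FA_mem] at h
      exact ⟨(D, D), ⟨⟨h.2.2, h.2.2, fun _ => rfl, fun _ => rfl⟩, rfl⟩, rfl⟩
    · rintro ⟨D, D'⟩ ⟨_, (e : D = D')⟩ ⟨E, E'⟩ ⟨_, (e' : E = E')⟩ b _ (h : D = b) (h' : E = b)
      subst e; subst e'; subst h; subst h'; rfl
    · rintro a _ b _ b' _ rfl rfl; rfl
  rw [h, Nat.card_coe_set_eq, Set.ncard_coe_finset, Finset.card_biUnion, Nat.cast_sum, Fintype.sum_prod_type]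
  · refine Finset.sum_congr rfl fun s _ => Finset.sum_congr rfl fun t _ => ?_
    rw [FA_card]
  · rintro ⟨s, t⟩ _ ⟨s', t'⟩ _ hne
    rw [Function.onFun, Finset.disjoint_left]
    rintro D h h'
    apply hne
    obtain ⟨rfl, rfl⟩ := FA_unique n s s' t t' D h h'
    rfl

open Classical in
noncomputable def FE (a : ℕ) : (k : ℕ) → (Fin (a + k) → Bool) → Finset (ℕ → ℕ → ℕ)
  | 0, t => if t = fun _ => false then {fun _ _ => 0} else ∅
  | k + 1, t => if t 0 then ((Finset.univ : Finset (Fin (a + k) → Bool)).filter fun t' => K (a + k) false t' (Fin.tail t)).biUnion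
      fun t' => (FE a k t').image (consD (hgt (a + k + 1) t)) else ∅

lemma FE_row (n k : ℕ) (t : Fin (n + k) → Bool) (D : ℕ → ℕ → ℕ) (h : D ∈ FE n k t) (p : ℕ) :
    D 0 p = hgt (n + k) t p := by
  cases k with
  | zero =>
    simp only [FE] at h
    split at h
    · simp at h; subst h; rename_i h; subst h; simp [hgt_false]
    · simp at h
  | succ k =>
    simp only [FE] at h
    split at h
    · simp only [Finset.mem_biUnion, Finset.mem_image] at h
      obtain ⟨t', _, D', _, rfl⟩ := h
      rfl
    · simp at h

lemma FE_card (a k : ℕ) (t : Fin (a + k) → Bool) : ((FE a k t).card : ℤ) = Cs a k t := by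
  classical
  induction k with
  | zero => simp only [FE, Cs_zero, vac_eq]; split <;> simp <;> assumption
  | succ k ih =>
    obtain ⟨h0, h1⟩ := Cs_succ a k
    have ht : t = Fin.cons (n := a + k) (t 0) (Fin.tail t) := (Fin.cons_self_tail (n := a + k) t).symm
    rw [FE]
    split
    · rename_i hh
      have : Cs a (k + 1) t = G (a + k) false (Cs a k) (Fin.tail t) := by
        rw [← h1, ht, hh]; rfl
      rw [this, G_kernel, Finset.card_biUnion, Finset.sum_filter, Nat.cast_sum]
      · refine Finset.sum_congr rfl fun t' _ => ?_
        split
        · rw [Finset.card_image_of_injective _ (consD_inj _), ih]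
        · simp
      · intro t1 _ t2 _ hne
        rw [Function.onFun, Finset.disjoint_left]
        intro D h1 h2
        rw [Finset.mem_image] at h1 h2
        obtain ⟨D1, h1, e1⟩ := h1
        obtain ⟨D2, h2, e2⟩ := h2
        have : D1 = D2 := consD_inj _ (e1.trans e2.symm)
        subst this
        apply hne
        apply hgt_inj
        intro p
        rw [← FE_row _ _ _ _ h1, ← FE_row _ _ _ _ h2]
    · rename_i hh
      have : Cs a (k + 1) t = e0 (n := a + k) (Cs a (k + 1)) (Fin.tail t) := by
        conv_lhs => rw [ht]
        rw [Bool.not_eq_true] at hh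
        rw [hh]; rfl
      rw [this, h0]; simp

structure ArE (m k : ℕ) (E : ℕ → ℕ → ℕ) : Prop where
  i : ∀ d q, E (d + 1) q ≤ E d (q + 1)
  ii : ∀ d q, E d (q + 2) ≤ E (d + 1) q
  iii : ∀ d q, E d q ≤ E d (q + 1) + 1
  iv : ∀ d q, k ≤ d → E d q = 0
  v : ∀ d q, m ≤ d + q → E d q = 0
  vi : ∀ d, E d 0 = k - d
  vii : ∀ d, E d 1 = k - d - 1

lemma FE_mem (a k : ℕ) (t : Fin (a + k) → Bool) (D : ℕ → ℕ → ℕ) :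
    D ∈ FE a k t ↔ (∀ p, D 0 p = hgt (a + k) t p) ∧ ArE (a + k) k D := by
  classical
  induction k generalizing D with
  | zero =>
    simp only [FE]
    constructor
    · intro h
      split at h
      · rename_i ht
        simp at h; subst h; subst ht
        exact ⟨fun p => by simp [hgt_false], by constructor <;> simp⟩
      · simp at h
    · rintro ⟨h1, h3⟩
      have : D = fun _ _ => 0 := by funext d p; exact h3.iv _ _ (by omega)
      rw [if_pos]
      · simp [this]
      · apply hgt_inj; intro p; rw [← h1, hgt_false, this]
  | succ k ih =>
    have hz : hgt (a + (k + 1)) t 0 = (t 0).toNat + hgt (a + k) (Fin.tail t) 0 := rfl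
    have hS : ∀ p, hgt (a + (k + 1)) t (p + 1) = hgt (a + k) (Fin.tail t) p := fun p => rfl
    simp only [FE]
    constructor
    · intro hD
      split at hD
      swap
      · simp at hD
      rename_i ht
      rw [ht] at hz
      simp only [Finset.mem_biUnion, Finset.mem_image, Finset.mem_filter, Finset.mem_univ, true_and] at hD
      obtain ⟨t', hK, D', hD', rfl⟩ := hD
      obtain ⟨h1, h3⟩ := (ih _ _).1 hD'
      have h10 := h1 0
      have h30 := h3.vi 0
      have hK1 := hK.1
      simp at hK1 hz
      refine ⟨fun p => rfl, ?_⟩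
      constructor
      · rintro (_ | d) p
        · simp only [consD, h1]; exact (hK.2 p).2
        · exact h3.i d p
      · rintro (_ | d) p
        · simp only [consD, h1]; exact (hK.2 p).1
        · exact h3.ii d p
      · rintro (_ | d) p
        · exact (hgt_step (a + k + 1) t p).2
        · exact h3.iii d p
      · rintro (_ | d) p h
        · omega
        · exact h3.iv d p (by omega)
      · rintro (_ | d) p h
        · exact hgt_ge (a + k + 1) t p (by omega)
        · exact h3.v d p (by omega)
      · rintro (_ | d)
        · change hgt (a + (k + 1)) t 0 = _
          omega
        · have := h3.vi d
          simp only [consD]; omega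
      · rintro (_ | d)
        · change hgt (a + (k + 1)) t (0 + 1) = _
          rw [hS]; omega
        · have := h3.vii d
          simp only [consD]; omega
    · rintro ⟨h1, h3⟩
      have h10 := h1 0
      have h11 := h1 1
      rw [hS] at h11
      have h30 := h3.vi 0
      have h31 := h3.vii 0
      have ht : t 0 = true := by
        cases h : t 0
        · rw [h] at hz; simp at hz; omega
        · rfl
      rw [if_pos ht]
      simp only [Finset.mem_biUnion, Finset.mem_image, Finset.mem_filter, Finset.mem_univ, true_and]
      obtain ⟨t', ht'⟩ := exists_bits (a + k) (D 1) (fun p hp => h3.v 1 p (by omega))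
        (fun p => ⟨by
          cases p with
          | zero => have := h3.vi 1; have := h3.vii 1; simp only [Nat.zero_add]; omega
          | succ p => exact (h3.ii 1 p).trans (h3.i 1 p), h3.iii 1 p⟩)
      have ht0 := ht' 0
      have h32 := h3.vi 1
      refine ⟨t', ⟨?_, fun p => ?_⟩, fun d => D (d + 1), (ih _ _).2 ⟨ht', ?_⟩, ?_⟩
      · simp; omega
      · rw [← hS, ← hS, ← h1, ← h1, ← ht']; exact ⟨h3.ii 0 p, h3.i 0 p⟩
      · exact ⟨fun d p => h3.i _ _, fun d p => h3.ii _ _, fun d p => h3.iii _ _,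
          fun d p h => h3.iv _ _ (by omega), fun d p h => h3.v _ _ (by omega),
          fun d => (h3.vi (d + 1)).trans (by omega), fun d => (h3.vii (d + 1)).trans (by omega)⟩
      · funext d p
        cases d with
        | zero => exact (h1 p).symm
        | succ d => rfl

end PP

namespace PP

lemma Arr.zero {n : ℕ} {D : ℕ → ℕ → ℕ} (h : Arr n n D) (d p : ℕ) (hn : n ≤ d + p) : D d p = 0 := by
  induction p generalizing d with
  | zero => exact h.iv _ _ hn
  | succ p ih => have := h.ii d p; have := ih (d + 1) (by omega); omega

lemma Arr.le {n : ℕ} {D : ℕ → ℕ → ℕ} (h : Arr n n D) (d p : ℕ) : D d p ≤ n - d - p := by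
  by_cases hn : n ≤ d + p
  · rw [h.zero d p hn]; omega
  · obtain ⟨k, hk⟩ : ∃ k, n = d + p + k := ⟨n - d - p, by omega⟩
    have : ∀ k p, n = d + p + k → D d p ≤ k := by
      intro k
      induction k with
      | zero => intro p hp; rw [h.zero d p (by omega)]
      | succ k ih => intro p hp; have := h.iii d p; have := ih (p + 1) (by omega); omega
    have := this k p hk
    omega

def comp (n : ℕ) (D : ℕ → ℕ → ℕ) : Prop := ∀ d p, d + p < n → D d p + D p d + d + p = n

lemma toE (a : ℕ) (D : ℕ → ℕ → ℕ) (h : Arr (2 * a) (2 * a) D) (hc : comp (2 * a) D) :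
    ArE (a + a) a (fun d q => D d (d + q)) := by
  have hd : ∀ d, D d d = a - d := by
    intro d
    by_cases hh : d < a
    · have := hc d d (by omega); omega
    · rw [h.zero d d (by omega)]; omega
  constructor
  · intro d q
    have := h.i d (d + (q + 1))
    rwa [show d + 1 + q = d + (q + 1) by omega]
  · intro d q
    have := h.ii d (d + 1 + q)
    rwa [show d + (q + 2) = d + 1 + q + 1 by omega]
  · intro d q
    exact h.iii d (d + q)
  · intro d q hh
    exact h.zero _ _ (by omega)
  · intro d q hh
    exact h.v _ _ (by omega)
  · intro d; exact hd d
  · intro d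
    change D d (d + 1) = _
    by_cases hh : d < a
    · have := hc d (d + 1) (by omega)
      have := h.ii d d
      have := h.i d d
      have := h.iii d d
      have := hd d
      omega
    · rw [h.zero _ _ (by omega)]; omega

def fromE (a : ℕ) (E : ℕ → ℕ → ℕ) (d p : ℕ) : ℕ :=
  if d ≤ p then E d (p - d) else if d + p < 2 * a then 2 * a - d - p - E p (d - p) else 0

lemma ArE.zero {a : ℕ} {E : ℕ → ℕ → ℕ} (h : ArE (a + a) a E) (q d : ℕ) (hh : 2 * a ≤ 2 * d + q) : E d q = 0 := by
  induction q using Nat.strong_induction_on generalizing d with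
  | _ q ih =>
    match q with
    | 0 => rw [h.vi]; omega
    | 1 => rw [h.vii]; omega
    | q + 2 => have := h.ii d q; have := ih q (by omega) (d + 1) (by omega); omega

lemma ArE.le {a : ℕ} {E : ℕ → ℕ → ℕ} (h : ArE (a + a) a E) (d q : ℕ) : E d q ≤ 2 * a - 2 * d - q := by
  by_cases hn : 2 * a ≤ 2 * d + q
  · rw [h.zero q d hn]; omega
  · have : ∀ k q, 2 * a = 2 * d + q + k → E d q ≤ k := by
      intro k
      induction k with
      | zero => intro p hp; rw [h.zero p d (by omega)]
      | succ k ih => intro p hp; have := h.iii d p; have := ih (p + 1) (by omega); omega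
    exact (this (2 * a - 2 * d - q) q (by omega))

lemma fromE_le (a : ℕ) (E : ℕ → ℕ → ℕ) (d p q : ℕ) (h : p = d + q) : fromE a E d p = E d q := by
  subst h; simp [fromE]

lemma fromE_gt (a : ℕ) (E : ℕ → ℕ → ℕ) (d p q : ℕ) (h : d = p + (q + 1)) :
    fromE a E d p = if d + p < 2 * a then 2 * a - d - p - E p (q + 1) else 0 := by
  subst h; simp [fromE]

lemma fromE_Arr (a : ℕ) (E : ℕ → ℕ → ℕ) (h : ArE (a + a) a E) : Arr (2 * a) (2 * a) (fromE a E) := by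
  constructor
  · intro d p
    rcases lt_trichotomy d p with hh | hh | hh
    · obtain ⟨q, rfl⟩ : ∃ q, p = d + 1 + q := ⟨p - d - 1, by omega⟩
      rw [fromE_le a E (d + 1) _ q rfl, fromE_le a E d _ (q + 1) (by omega)]
      exact h.i d q
    · subst hh
      rw [fromE_gt a E (d + 1) d 0 (by omega), fromE_le a E d d 0 rfl, h.vi, h.vii]
      split <;> omega
    · obtain ⟨q, rfl⟩ : ∃ q, d = p + (q + 1) := ⟨d - p - 1, by omega⟩
      rw [fromE_gt a E (p + (q + 1) + 1) p (q + 1) (by omega), fromE_gt a E _ p q rfl]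
      have := h.iii p (q + 1)
      split <;> split <;> omega
  · intro d p
    rcases lt_trichotomy d p with hh | hh | hh
    · obtain ⟨q, rfl⟩ : ∃ q, p = d + 1 + q := ⟨p - d - 1, by omega⟩
      rw [fromE_le a E (d + 1) _ q rfl, fromE_le a E d _ (q + 2) (by omega)]
      exact h.ii d q
    · subst hh
      rw [fromE_gt a E (d + 1) d 0 (by omega), fromE_le a E d (d + 1) 1 rfl, h.vii]
      split <;> omega
    · obtain ⟨q, rfl⟩ : ∃ q, d = p + (q + 1) := ⟨d - p - 1, by omega⟩
      rw [fromE_gt a E (p + (q + 1) + 1) p (q + 1) (by omega)]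
      cases q with
      | zero =>
        rw [fromE_le a E _ (p + 1) 0 (by omega), h.vi]
        have := h.ii p 0
        rw [h.vi] at this
        simp only [Nat.zero_add, Nat.reduceAdd] at *
        split <;> omega
      | succ q =>
        rw [fromE_gt a E _ (p + 1) q (by omega)]
        have := h.ii p (q + 1)
        simp only [Nat.add_assoc, Nat.reduceAdd] at *
        split <;> split <;> omega
  · intro d p
    rcases le_or_gt d p with hh | hh
    · obtain ⟨q, rfl⟩ : ∃ q, p = d + q := ⟨p - d, by omega⟩
      rw [fromE_le a E d _ q rfl, fromE_le a E d _ (q + 1) (by omega)]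
      exact h.iii d q
    · obtain ⟨q, rfl⟩ : ∃ q, d = p + (q + 1) := ⟨d - p - 1, by omega⟩
      rw [fromE_gt a E _ p q rfl]
      cases q with
      | zero =>
        rw [fromE_le a E _ (p + 1) 0 (by omega), h.vi, h.vii]
        split <;> omega
      | succ q =>
        rw [fromE_gt a E _ (p + 1) q (by omega)]
        have := h.i p (q + 1)
        have := h.le (p + 1) (q + 1)
        simp only [Nat.add_assoc, Nat.reduceAdd] at *
        split <;> split <;> omega
  · intro d p hn
    rcases le_or_gt d p with hh | hh
    · rw [fromE_le a E d p (p - d) (by omega), h.iv _ _ (by omega)]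
    · rw [fromE_gt a E d p (d - p - 1) (by omega), if_neg (by omega)]
  · intro d p hn
    rcases le_or_gt d p with hh | hh
    · rw [fromE_le a E d p (p - d) (by omega), h.v _ _ (by omega)]
    · rw [fromE_gt a E d p (d - p - 1) (by omega), if_neg (by omega)]

lemma fromE_comp (a : ℕ) (E : ℕ → ℕ → ℕ) (h : ArE (a + a) a E) : comp (2 * a) (fromE a E) := by
  have key : ∀ p q, p + (q + 1) + p < 2 * a → fromE a E (p + (q + 1)) p + fromE a E p (p + (q + 1)) + (p + (q + 1)) + p = 2 * a := by
    intro p q hh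
    rw [fromE_gt a E _ p q rfl, fromE_le a E p _ (q + 1) rfl, if_pos hh]
    have := h.le p (q + 1)
    omega
  intro d p hn
  rcases lt_trichotomy d p with hh | hh | hh
  · have := key d (p - d - 1) (by omega)
    rw [show d + (p - d - 1 + 1) = p by omega] at this
    omega
  · subst hh
    rw [fromE_le a E d d 0 rfl, h.vi]; omega
  · have := key p (d - p - 1) (by omega)
    rw [show p + (d - p - 1 + 1) = d by omega] at this
    omega

lemma comp_unique (n : ℕ) (D D' : ℕ → ℕ → ℕ) (h : Arr n n D) (h' : Arr n n D') (hc : comp n D) (hc' : comp n D')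
    (e : ∀ d q, D d (d + q) = D' d (d + q)) : D = D' := by
  funext d p
  rcases le_or_gt d p with hh | hh
  · have := e d (p - d)
    rwa [show d + (p - d) = p by omega] at this
  · have := e p (d - p)
    rw [show p + (d - p) = d by omega] at this
    by_cases hn : d + p < n
    · have := hc d p hn; have := hc' d p hn; omega
    · rw [h.zero _ _ (by omega), h'.zero _ _ (by omega)]

lemma PC_card (a : ℕ) : (Nat.card ({x | x ∈ PS (2 * a) ∧ comp (2 * a) x.1 ∧ comp (2 * a) x.2} : Set _) : ℤ) =
    ∑ t, Cs a a t * Cs a a t := by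
  classical
  have h : Nat.card ({x | x ∈ PS (2 * a) ∧ comp (2 * a) x.1 ∧ comp (2 * a) x.2} : Set _) =
      Nat.card (↑((Finset.univ : Finset (Fin (a + a) → Bool)).biUnion
      fun t => FE a a t ×ˢ FE a a t) : Set ((ℕ → ℕ → ℕ) × (ℕ → ℕ → ℕ))) := by
    refine card_of_rel _ _ (fun x y => (∀ d q, y.1 d q = x.1 d (d + q)) ∧ (∀ d q, y.2 d q = x.2 d (d + q))) ?_ ?_ ?_ ?_
    · rintro ⟨D, D'⟩ ⟨⟨h1, h2, h3, h4⟩, h5, h6⟩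
      simp only at h1 h2 h3 h4 h5 h6
      obtain ⟨t, ht⟩ := exists_bits (a + a) (D 0) (fun p hp => h1.v 0 p (by omega))
        (fun p => ⟨(h1.ii 0 p).trans (h1.i 0 p), h1.iii 0 p⟩)
      refine ⟨(fun d q => D d (d + q), fun d q => D' d (d + q)), ?_, fun _ _ => rfl, fun _ _ => rfl⟩
      simp only [Finset.coe_biUnion, Set.mem_iUnion, Finset.mem_coe, Finset.mem_product, FE_mem]
      refine ⟨t, Finset.mem_univ _, ⟨?_, toE a D h1 h5⟩, ?_, toE a D' h2 h6⟩
      · intro p; simp only [Nat.zero_add]; exact ht p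
      · intro p; simp only [Nat.zero_add]; rw [← h3]; exact ht p
    · rintro ⟨E, E'⟩ h
      simp only [Finset.coe_biUnion, Set.mem_iUnion, Finset.mem_coe, Finset.mem_product, FE_mem] at h
      obtain ⟨t, _, ⟨h1, h2⟩, h3, h4⟩ := h
      have e : ∀ p, E 0 p = E' 0 p := fun p => (h1 p).trans (h3 p).symm
      refine ⟨(fromE a E, fromE a E'), ⟨⟨fromE_Arr a E h2, fromE_Arr a E' h4, ?_, ?_⟩, fromE_comp a E h2, fromE_comp a E' h4⟩, ?_, ?_⟩
      · intro p
        simp only [fromE_le a _ 0 p p (Nat.zero_add p).symm, e]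
      · rintro (_ | d)
        · simp only [fromE_le a _ 0 0 0 rfl, e]
        · simp only [fromE_gt a _ (d + 1) 0 d (Nat.zero_add _).symm, e]
      · intro d q; exact (fromE_le a E d _ q rfl).symm
      · intro d q; exact (fromE_le a E' d _ q rfl).symm
    · rintro ⟨D1, D1'⟩ ⟨⟨h1, h2, _, _⟩, h3, h4⟩ ⟨D2, D2'⟩ ⟨⟨k1, k2, _, _⟩, k3, k4⟩ ⟨E, E'⟩ _ ⟨e1, e2⟩ ⟨f1, f2⟩
      simp only at *
      rw [comp_unique _ D1 D2 h1 k1 h3 k3 (fun d q => (e1 d q).symm.trans (f1 d q)),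
        comp_unique _ D1' D2' h2 k2 h4 k4 (fun d q => (e2 d q).symm.trans (f2 d q))]
    · rintro x _ ⟨E, E'⟩ _ ⟨F, F'⟩ _ ⟨e1, e2⟩ ⟨f1, f2⟩
      simp only at *
      have : E = F := by funext d q; rw [e1, f1]
      have : E' = F' := by funext d q; rw [e2, f2]
      subst E E'; rfl
  rw [h, Nat.card_coe_set_eq, Set.ncard_coe_finset, Finset.card_biUnion, Nat.cast_sum]
  · refine Finset.sum_congr rfl fun t _ => ?_
    rw [Finset.card_product, Nat.cast_mul, FE_card]
  · intro t _ t' _ hne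
    rw [Function.onFun, Finset.disjoint_left]
    rintro ⟨D, D'⟩ h h'
    apply hne
    rw [Finset.mem_product] at h h'
    apply hgt_inj
    intro p
    rw [← FE_row _ _ _ _ h.1, ← FE_row _ _ _ _ h'.1]

end PP

namespace PP

structure Good (n : ℕ) (P : ℕ → ℕ → ℕ → Prop) : Prop where
  b : ∀ x y z, P x y z → x < n
  l : ∀ x y z, P (x + 1) y z → P x y z
  c : ∀ x y z, P x y z ↔ P y z x

def QD (P : ℕ → ℕ → ℕ → Prop) (D D' : ℕ → ℕ → ℕ) : Prop :=
  ∀ z p d, (z < D d p ↔ P (z + p + d) (z + p) z) ∧ (z < D' d p ↔ P (z + p + d) z (z + p))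

lemma QD_left (P P' : ℕ → ℕ → ℕ → Prop) (D D' : ℕ → ℕ → ℕ) (h : QD P D D') (h' : QD P' D D')
    (c : ∀ x y z, P x y z ↔ P y z x) (c' : ∀ x y z, P' x y z ↔ P' y z x) : P = P' := by
  have A : ∀ x y z, z ≤ y → y ≤ x → (P x y z ↔ P' x y z) := by
    intro x y z h1 h2
    obtain ⟨p, rfl⟩ := Nat.exists_eq_add_of_le h1
    obtain ⟨d, rfl⟩ := Nat.exists_eq_add_of_le h2
    rw [← (h z p d).1, ← (h' z p d).1]
  have B : ∀ x y z, y ≤ z → z ≤ x → (P x y z ↔ P' x y z) := by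
    intro x y z h1 h2
    obtain ⟨p, rfl⟩ := Nat.exists_eq_add_of_le h1
    obtain ⟨d, rfl⟩ := Nat.exists_eq_add_of_le h2
    rw [← (h y p d).2, ← (h' y p d).2]
  have C : ∀ x y z, y ≤ x → z ≤ x → (P x y z ↔ P' x y z) := by
    intro x y z h1 h2
    rcases le_total y z with h3 | h3
    · exact B _ _ _ h3 h2
    · exact A _ _ _ h3 h1
  funext x y z
  apply propext
  by_cases h1 : y ≤ x ∧ z ≤ x
  · exact C _ _ _ h1.1 h1.2
  · by_cases h2 : z ≤ y ∧ x ≤ y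
    · rw [c, c' x]; exact C _ _ _ h2.1 h2.2
    · rw [← c, ← c' z]; exact C _ _ _ (by omega) (by omega)

lemma eq_of_lt_iff (a b : ℕ) (h : ∀ z, z < a ↔ z < b) : a = b := by
  have := h a; have := h b; omega

lemma QD_right (P : ℕ → ℕ → ℕ → Prop) (D D' E E' : ℕ → ℕ → ℕ) (h : QD P D D') (h' : QD P E E') :
    D = E ∧ D' = E' := by
  constructor <;> funext d p <;> apply eq_of_lt_iff <;> intro z
  · rw [(h z p d).1, (h' z p d).1]
  · rw [(h z p d).2, (h' z p d).2]

lemma exists_thr (n : ℕ) (Q : ℕ → Prop) (h : ∀ z, Q (z + 1) → Q z) (hb : ∀ z, Q z → z < n) :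
    ∃ c, ∀ z, z < c ↔ Q z := by
  classical
  have hex : ∃ z, ¬ Q z := ⟨n, fun hh => by have := hb _ hh; omega⟩
  refine ⟨Nat.find hex, fun z => ⟨fun hz => not_not.1 (Nat.find_min hex hz), fun hz => ?_⟩⟩
  by_contra hc
  have : ∀ k, Q (Nat.find hex + k) → Q (Nat.find hex) := by
    intro k
    induction k with
    | zero => exact id
    | succ k ih => exact fun hk => ih (h _ hk)
  apply Nat.find_spec hex
  apply this (z - Nat.find hex)
  rwa [show Nat.find hex + (z - Nat.find hex) = z by omega]

lemma le_of_lt_imp (a b : ℕ) (h : ∀ z, z < a → z < b) : a ≤ b := by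
  by_contra hc
  have := h b (by omega); omega

lemma Good.l2 {n : ℕ} {P : ℕ → ℕ → ℕ → Prop} (h : Good n P) (x y z : ℕ) (hh : P x (y + 1) z) : P x y z := by
  rw [h.c] at hh ⊢; exact h.l _ _ _ hh

lemma Good.l3 {n : ℕ} {P : ℕ → ℕ → ℕ → Prop} (h : Good n P) (x y z : ℕ) (hh : P x y (z + 1)) : P x y z := by
  rw [← h.c] at hh ⊢; exact h.l _ _ _ hh

lemma Good.b2 {n : ℕ} {P : ℕ → ℕ → ℕ → Prop} (h : Good n P) (x y z : ℕ) (hh : P x y z) : y < n := by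
  rw [h.c] at hh; exact h.b _ _ _ hh

lemma Good.b3 {n : ℕ} {P : ℕ → ℕ → ℕ → Prop} (h : Good n P) (x y z : ℕ) (hh : P x y z) : z < n := by
  rw [← h.c] at hh; exact h.b _ _ _ hh

lemma Good_to_D (n : ℕ) (P : ℕ → ℕ → ℕ → Prop) (h : Good n P) : ∃ x ∈ PS n, QD P x.1 x.2 := by
  have h1 : ∀ d p, ∃ c, ∀ z, z < c ↔ P (z + p + d) (z + p) z := fun d p => by
    apply exists_thr n
    · intro z hz
      rw [show z + 1 + p + d = z + p + d + 1 by omega, show z + 1 + p = z + p + 1 by omega] at hz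
      exact h.l _ _ _ (h.l2 _ _ _ (h.l3 _ _ _ hz))
    · intro z hz; exact h.b3 _ _ _ hz
  have h2 : ∀ d p, ∃ c, ∀ z, z < c ↔ P (z + p + d) z (z + p) := fun d p => by
    apply exists_thr n
    · intro z hz
      rw [show z + 1 + p + d = z + p + d + 1 by omega, show z + 1 + p = z + p + 1 by omega] at hz
      exact h.l _ _ _ (h.l2 _ _ _ (h.l3 _ _ _ hz))
    · intro z hz; exact h.b2 _ _ _ hz
  choose D hD using h1
  choose D' hD' using h2
  refine ⟨(D, D'), ⟨?_, ?_, ?_, ?_⟩, fun z p d => ⟨hD d p z, hD' d p z⟩⟩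
  · constructor
    · intro d p; apply le_of_lt_imp; intro z; rw [hD, hD]; exact fun hh => h.l _ _ _ hh
    · intro d p; apply le_of_lt_imp; intro z; rw [hD, hD]
      intro hh; apply h.l2; convert hh using 1 <;> omega
    · intro d p; apply le_of_lt_imp
      rintro (_ | z)
      · omega
      · rw [Nat.add_lt_add_iff_right, hD, hD]
        intro hh; apply h.l3; convert hh using 1 <;> omega
    · intro d p hn
      by_contra hc
      simp only at hc
      have := h.b _ _ _ ((hD d p 0).1 (by omega)); omega
    · intro d p hn
      by_contra hc
      simp only at hc
      have := h.b _ _ _ ((hD d p 0).1 (by omega)); omega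
  · constructor
    · intro d p; apply le_of_lt_imp; intro z; rw [hD', hD']; exact fun hh => h.l _ _ _ hh
    · intro d p; apply le_of_lt_imp; intro z; rw [hD', hD']
      intro hh; apply h.l3; convert hh using 1 <;> omega
    · intro d p; apply le_of_lt_imp
      rintro (_ | z)
      · omega
      · rw [Nat.add_lt_add_iff_right, hD', hD']
        intro hh; apply h.l2; convert hh using 1 <;> omega
    · intro d p hn
      by_contra hc
      simp only at hc
      have := h.b _ _ _ ((hD' d p 0).1 (by omega)); omega
    · intro d p hn
      by_contra hc
      simp only at hc
      have := h.b _ _ _ ((hD' d p 0).1 (by omega)); omega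
  · intro p; apply eq_of_lt_iff; intro z
    simp only; rw [hD, hD']; exact h.c (z + p) (z + p) z
  · intro d; apply eq_of_lt_iff; intro z
    simp only; rw [hD, hD']; rfl

def PP0 (D D' : ℕ → ℕ → ℕ) (x y z : ℕ) : Prop :=
  ∃ w p d, (w < D d p ∧ x = w + p + d ∧ y = w + p ∧ z = w) ∨ (w < D' d p ∧ x = w + p + d ∧ y = w ∧ z = w + p)

lemma D_to_Good (n : ℕ) (D D' : ℕ → ℕ → ℕ) (h : (D, D') ∈ PS n) : ∃ P, Good n P ∧ QD P D D' := by
  obtain ⟨h1, h2, h3, h4⟩ := h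
  simp only at h1 h2 h3 h4
  have P0A : ∀ w p d, PP0 D D' (w + p + d) (w + p) w ↔ w < D d p := by
    intro w p d
    constructor
    · rintro ⟨w', p', d', ⟨h, e1, e2, e3⟩ | ⟨h, e1, e2, e3⟩⟩
      · obtain rfl : w = w' := by omega
        obtain rfl : p = p' := by omega
        obtain rfl : d = d' := by omega
        exact h
      · obtain rfl : p' = 0 := by omega
        obtain rfl : p = 0 := by omega
        obtain rfl : w = w' := by omega
        obtain rfl : d = d' := by omega
        rwa [h4]
    · exact fun h => ⟨w, p, d, Or.inl ⟨h, rfl, rfl, rfl⟩⟩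
  have P0B : ∀ w p d, PP0 D D' (w + p + d) w (w + p) ↔ w < D' d p := by
    intro w p d
    constructor
    · rintro ⟨w', p', d', ⟨h, e1, e2, e3⟩ | ⟨h, e1, e2, e3⟩⟩
      · obtain rfl : p' = 0 := by omega
        obtain rfl : p = 0 := by omega
        obtain rfl : w = w' := by omega
        obtain rfl : d = d' := by omega
        rwa [← h4]
      · obtain rfl : w = w' := by omega
        obtain rfl : p = p' := by omega
        obtain rfl : d = d' := by omega
        exact h
    · exact fun h => ⟨w, p, d, Or.inr ⟨h, rfl, rfl, rfl⟩⟩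
  have hy : ∀ x y z, PP0 D D' x y z → y ≤ x ∧ z ≤ x := by
    rintro x y z ⟨w', p', d', ⟨h, e1, e2, e3⟩ | ⟨h, e1, e2, e3⟩⟩ <;> omega
  -- agreement where two coordinates tie for the maximum
  have tie : ∀ x z, PP0 D D' x x z ↔ PP0 D D' x z x := by
    intro x z
    by_cases hz : z ≤ x
    · obtain ⟨p, rfl⟩ := Nat.exists_eq_add_of_le hz
      have e1 := P0A z p 0
      have e2 := P0B z p 0
      simp only [Nat.add_zero] at e1 e2
      rw [e1, e2, h3]
    · constructor <;> intro h <;> have := hy _ _ _ h <;> omega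
  let P : ℕ → ℕ → ℕ → Prop := fun x y z => PP0 D D' x y z ∨ PP0 D D' y z x ∨ PP0 D D' z x y
  have hc : ∀ x y z, P x y z ↔ P y z x := by intro x y z; simp only [P]; tauto
  have hP : ∀ x y z, y ≤ x → z ≤ x → (P x y z ↔ PP0 D D' x y z) := by
    intro x y z hy1 hz1
    refine ⟨?_, Or.inl⟩
    rintro (h | h | h)
    · exact h
    · have := hy _ _ _ h
      obtain rfl : x = y := by omega
      exact (tie _ _).2 h
    · have := hy _ _ _ h
      obtain rfl : x = z := by omega
      exact (tie _ _).1 h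
  have hA : ∀ w p d, P (w + p + d) (w + p) w ↔ w < D d p := fun w p d => by
    rw [hP _ _ _ (by omega) (by omega), P0A]
  have hB : ∀ w p d, P (w + p + d) w (w + p) ↔ w < D' d p := fun w p d => by
    rw [hP _ _ _ (by omega) (by omega), P0B]
  refine ⟨P, ⟨?_, ?_, hc⟩, fun z p d => ⟨(hA z p d).symm, (hB z p d).symm⟩⟩
  · have hb0 : ∀ x y z, PP0 D D' x y z → x < n := by
      rintro x y z ⟨w', p', d', ⟨h, e1, e2, e3⟩ | ⟨h, e1, e2, e3⟩⟩
      · have := h1.le d' p'; omega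
      · have := h2.le d' p'; omega
    rintro x y z (h | h | h)
    · exact hb0 _ _ _ h
    · have := hb0 _ _ _ h; have := hy _ _ _ h; omega
    · have := hb0 _ _ _ h; have := hy _ _ _ h; omega
  · intro x y z
    by_cases c1 : y ≤ x ∧ z ≤ x
    · rcases le_total z y with c2 | c2
      · obtain ⟨p, rfl⟩ := Nat.exists_eq_add_of_le c2
        obtain ⟨d, rfl⟩ := Nat.exists_eq_add_of_le c1.1
        rw [hA z p d, Nat.add_assoc (z + p), hA z p (d + 1)]
        have := h1.i d p; omega
      · obtain ⟨p, rfl⟩ := Nat.exists_eq_add_of_le c2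
        obtain ⟨d, rfl⟩ := Nat.exists_eq_add_of_le c1.2
        rw [hB y p d, Nat.add_assoc (y + p), hB y p (d + 1)]
        have := h2.i d p; omega
    · by_cases c2 : z ≤ y ∧ x + 1 ≤ y
      · rw [hc, hc x]
        by_cases c3 : x + 1 ≤ z
        · obtain ⟨p, rfl⟩ := Nat.exists_eq_add_of_le c3
          obtain ⟨d, rfl⟩ := Nat.exists_eq_add_of_le c2.1
          rw [hA (x + 1) p d, show x + 1 + p = x + (p + 1) by omega, hA x (p + 1) d]
          have := h1.iii d p; omega
        · obtain ⟨p, rfl⟩ := Nat.exists_eq_add_of_le (show z ≤ x by omega)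
          obtain ⟨d, rfl⟩ := Nat.exists_eq_add_of_le c2.2
          rw [show z + p + 1 = z + (p + 1) by omega, hB z (p + 1) d,
            show z + (p + 1) + d = z + p + (d + 1) by omega, hB z p (d + 1)]
          have := h2.ii d p; omega
      · have c4 : y ≤ z ∧ x + 1 ≤ z := by omega
        rw [← hc, ← hc z]
        by_cases c3 : x + 1 ≤ y
        · obtain ⟨p, rfl⟩ := Nat.exists_eq_add_of_le c3
          obtain ⟨d, rfl⟩ := Nat.exists_eq_add_of_le c4.1
          rw [hB (x + 1) p d, show x + 1 + p = x + (p + 1) by omega, hB x (p + 1) d]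
          have := h2.iii d p; omega
        · obtain ⟨p, rfl⟩ := Nat.exists_eq_add_of_le (show y ≤ x by omega)
          obtain ⟨d, rfl⟩ := Nat.exists_eq_add_of_le c4.2
          rw [show y + p + 1 = y + (p + 1) by omega, hA y (p + 1) d,
            show y + (p + 1) + d = y + p + (d + 1) by omega, hA y p (d + 1)]
          have := h1.ii d p; omega

lemma sym_iff (n : ℕ) (P : ℕ → ℕ → ℕ → Prop) (hP : Good n P) (D D' : ℕ → ℕ → ℕ) (h : QD P D D') :
    (∀ x y z, P y x z ↔ P x y z) ↔ D = D' := by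
  have hs : QD (fun x y z => P y x z) D' D := by
    intro z p d
    rw [(h z p d).1, (h z p d).2]
    exact ⟨(hP.c _ _ _).symm, (hP.c _ _ _).symm⟩
  have hcs : ∀ x y z, P y x z ↔ P z y x := fun x y z => (hP.c _ _ _).symm
  constructor
  · intro hh
    have e : (fun x y z => P y x z) = P := by funext x y z; exact propext (hh x y z)
    rw [e] at hs
    exact (QD_right P D D' D' D h hs).1
  · rintro rfl x y z
    have := QD_left _ _ D D hs h hcs hP.c
    exact iff_of_eq (congrFun (congrFun (congrFun this x) y) z)

lemma comp_iff (n : ℕ) (P : ℕ → ℕ → ℕ → Prop) (hP : Good n P) (D D' : ℕ → ℕ → ℕ) (h : QD P D D')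
    (hPS : (D, D') ∈ PS n) :
    (∀ x y z, x < n → y < n → z < n → (¬ P (n - 1 - x) (n - 1 - y) (n - 1 - z) ↔ P y x z)) ↔ comp n D ∧ comp n D' := by
  have h1 : Arr n n D := hPS.1
  have h2 : Arr n n D' := hPS.2.1
  let P3 : ℕ → ℕ → ℕ → Prop := fun x y z => x < n ∧ y < n ∧ z < n ∧ ¬ P (n - 1 - y) (n - 1 - x) (n - 1 - z)
  have hc3 : ∀ x y z, P3 x y z ↔ P3 y z x := by
    intro x y z
    simp only [P3]
    rw [hP.c (n - 1 - z)]; tauto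
  have e0 : (∀ x y z, x < n → y < n → z < n → (¬ P (n - 1 - x) (n - 1 - y) (n - 1 - z) ↔ P y x z)) ↔ P3 = P := by
    constructor
    · intro hh
      funext x y z
      apply propext
      simp only [P3]
      constructor
      · rintro ⟨hx, hy, hz, h⟩; exact (hh y x z hy hx hz).1 h
      · intro h
        have hx := hP.b _ _ _ h
        have hy := hP.b2 _ _ _ h
        have hz := hP.b3 _ _ _ h
        exact ⟨hx, hy, hz, (hh y x z hy hx hz).2 h⟩
    · intro hh x y z hx hy hz
      conv_rhs => rw [← hh]
      simp only [P3]; tauto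
  rw [e0]
  have k1 : ∀ z p d, P3 (z + p + d) (z + p) z ↔ z + p + d + D p d < n := by
    intro z p d
    simp only [P3]
    by_cases hn : z + p + d < n
    · have := (h (n - 1 - (z + p + d)) d p).1
      rw [show n - 1 - (z + p + d) + d + p = n - 1 - z by omega,
        show n - 1 - (z + p + d) + d = n - 1 - (z + p) by omega, hP.c] at this
      rw [← this]; omega
    · omega
  have k2 : ∀ z p d, P3 (z + p + d) z (z + p) ↔ z + p + d + D' p d < n := by
    intro z p d
    simp only [P3]
    by_cases hn : z + p + d < n
    · have := (h (n - 1 - (z + p + d)) d p).2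
      rw [show n - 1 - (z + p + d) + d + p = n - 1 - z by omega,
        show n - 1 - (z + p + d) + d = n - 1 - (z + p) by omega] at this
      rw [← this]; omega
    · omega
  constructor
  · intro e
    rw [e] at k1 k2
    constructor
    · intro d p hn
      have hz : ∀ z, z < D d p ↔ z + p + d + D p d < n := fun z => (h z p d).1.trans (k1 z p d)
      have e1 := hz (n - p - d - D p d)
      have e2 := hz (D d p)
      have := h1.le p d
      omega
    · intro d p hn
      have hz : ∀ z, z < D' d p ↔ z + p + d + D' p d < n := fun z => (h z p d).2.trans (k2 z p d)
      have e1 := hz (n - p - d - D' p d)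
      have e2 := hz (D' d p)
      have := h2.le p d
      omega
  · rintro ⟨c1, c2⟩
    apply QD_left P3 P D D' _ h hc3 hP.c
    intro z p d
    rw [k1, k2]
    by_cases hn : d + p < n
    · have := c1 d p hn; have := c2 d p hn; omega
    · rw [h1.zero d p (by omega), h2.zero d p (by omega)]; omega

/-- membership predicate on natural numbers -/
def mm {n : ℕ} (T : Set (Fin n × Fin n × Fin n)) (x y z : ℕ) : Prop :=
  ∃ (hx : x < n) (hy : y < n) (hz : z < n), ((⟨x, hx⟩, ⟨y, hy⟩, ⟨z, hz⟩) : Fin n × Fin n × Fin n) ∈ T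

lemma mm_fin {n : ℕ} (T : Set (Fin n × Fin n × Fin n)) (x y z : Fin n) : mm T x y z ↔ (x, y, z) ∈ T :=
  ⟨fun ⟨_, _, _, h⟩ => h, fun h => ⟨x.2, y.2, z.2, h⟩⟩

lemma mm_inj {n : ℕ} (T T' : Set (Fin n × Fin n × Fin n)) (h : mm T = mm T') : T = T' := by
  ext ⟨x, y, z⟩
  rw [← mm_fin, ← mm_fin, h]

lemma mm_good {n : ℕ} (T : Set (Fin n × Fin n × Fin n)) (h : IsLowerSet T) (hc : ppCycle T = T) : Good n (mm T) := by
  constructor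
  · rintro x y z ⟨hx, _⟩; exact hx
  · rintro x y z ⟨hx, hy, hz, hT⟩
    refine ⟨by omega, hy, hz, h ?_ hT⟩
    refine ⟨?_, le_refl _, le_refl _⟩
    simp
  · have : ∀ u, u ∈ T ↔ (u.2.1, u.2.2, u.1) ∈ T := fun u => by
      conv_lhs => rw [← hc]
      rfl
    intro x y z
    constructor
    · rintro ⟨hx, hy, hz, hT⟩; exact ⟨hy, hz, hx, (this _).1 hT⟩
    · rintro ⟨hx, hy, hz, hT⟩; exact ⟨hz, hx, hy, (this _).2 hT⟩

lemma good_mm {n : ℕ} (P : ℕ → ℕ → ℕ → Prop) (h : Good n P) :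
    ∃ T : Set (Fin n × Fin n × Fin n), IsLowerSet T ∧ ppCycle T = T ∧ mm T = P := by
  have l1 : ∀ y z x' x, x ≤ x' → P x' y z → P x y z := by
    intro y z x' x hx
    induction x', hx using Nat.le_induction with
    | base => exact id
    | succ x' _ ih => exact fun hh => ih (h.l _ _ _ hh)
  have ll : ∀ x y z x' y' z', x ≤ x' → y ≤ y' → z ≤ z' → P x' y' z' → P x y z := by
    intro x y z x' y' z' hx hy hz hh
    have e1 := l1 _ _ _ _ hx hh
    rw [h.c] at e1
    have e2 := l1 _ _ _ _ hy e1
    rw [h.c] at e2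
    have e3 := l1 _ _ _ _ hz e2
    rwa [h.c] at e3
  refine ⟨{u | P u.1 u.2.1 u.2.2}, ?_, ?_, ?_⟩
  · rintro ⟨x', y', z'⟩ ⟨x, y, z⟩ ⟨hx, hy, hz⟩ hh
    exact ll _ _ _ _ _ _ hx hy hz hh
  · ext ⟨x, y, z⟩
    exact (h.c _ _ _).symm
  · funext x y z
    apply propext
    constructor
    · rintro ⟨_, _, _, h⟩; exact h
    · intro hh; exact ⟨h.b _ _ _ hh, h.b2 _ _ _ hh, h.b3 _ _ _ hh, hh⟩

lemma count (n : ℕ) (A : Set (Fin n × Fin n × Fin n) → Prop) (B : (ℕ → ℕ → ℕ) × (ℕ → ℕ → ℕ) → Prop)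
    (hAB : ∀ T x, IsLowerSet T → ppCycle T = T → x ∈ PS n → QD (mm T) x.1 x.2 → (A T ↔ B x)) :
    Nat.card ({T | IsLowerSet T ∧ ppCycle T = T ∧ A T} : Set (Set (Fin n × Fin n × Fin n))) =
      Nat.card ({x | x ∈ PS n ∧ B x} : Set ((ℕ → ℕ → ℕ) × (ℕ → ℕ → ℕ))) := by
  refine card_of_rel _ _ (fun T x => QD (mm T) x.1 x.2) ?_ ?_ ?_ ?_
  · rintro T ⟨h1, h2, h3⟩
    obtain ⟨x, hx, hq⟩ := Good_to_D n _ (mm_good T h1 h2)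
    exact ⟨x, ⟨hx, (hAB T x h1 h2 hx hq).1 h3⟩, hq⟩
  · rintro ⟨D, D'⟩ ⟨hx, hB⟩
    obtain ⟨P, hP, hq⟩ := D_to_Good n D D' hx
    obtain ⟨T, h1, h2, rfl⟩ := good_mm P hP
    exact ⟨T, ⟨h1, h2, (hAB T _ h1 h2 hx hq).2 hB⟩, hq⟩
  · rintro T ⟨h1, h2, _⟩ T' ⟨h1', h2', _⟩ x _ hq hq'
    exact mm_inj _ _ (QD_left _ _ _ _ hq hq' (mm_good T h1 h2).c (mm_good T' h1' h2').c)
  · rintro T _ ⟨D, D'⟩ _ ⟨E, E'⟩ _ hq hq'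
    obtain ⟨e, e'⟩ := QD_right _ _ _ _ _ hq hq'
    simp only at e e'
    rw [e, e']

lemma main (a : ℕ) :
    Nat.card {T : Set (Fin (2 * a) × Fin (2 * a) × Fin (2 * a)) //
        IsLowerSet T ∧ ppCycle T = T}
      = Nat.card {T : Set (Fin (2 * a) × Fin (2 * a) × Fin (2 * a)) //
          IsLowerSet T ∧ ppTranspose T = T ∧ ppCycle T = T}
        * Nat.card {T : Set (Fin (2 * a) × Fin (2 * a) × Fin (2 * a)) //
            IsLowerSet T ∧ ppCycle T = T ∧ ppComplement T = ppTranspose T} := by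
  have c1 := count (2 * a) (fun _ => True) (fun _ => True) (fun _ _ _ _ _ _ => Iff.rfl)
  have c2 := count (2 * a) (fun T => ppTranspose T = T) (fun x => x.1 = x.2) (by
    intro T x h1 h2 hx hq
    rw [← sym_iff _ _ (mm_good T h1 h2) _ _ hq]
    constructor
    · intro e x y z
      have : ∀ u, (u.2.1, u.1, u.2.2) ∈ T ↔ u ∈ T := fun u => by
        conv_rhs => rw [← e]
        rfl
      constructor
      · rintro ⟨hx, hy, hz, hT⟩; exact ⟨hy, hx, hz, (this _).1 hT⟩
      · rintro ⟨hx, hy, hz, hT⟩; exact ⟨hy, hx, hz, (this _).2 hT⟩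
    · intro e
      ext ⟨x, y, z⟩
      have := e x y z
      rw [mm_fin, mm_fin] at this
      exact this)
  have c3 := count (2 * a) (fun T => ppComplement T = ppTranspose T) (fun x => comp (2 * a) x.1 ∧ comp (2 * a) x.2) (by
    intro T x h1 h2 hx hq
    rw [← comp_iff _ _ (mm_good T h1 h2) _ _ hq hx]
    have hr : ∀ x : Fin (2 * a), ((x.rev : Fin (2 * a)) : ℕ) = 2 * a - 1 - x := fun x => by
      rw [Fin.val_rev]; omega
    constructor
    · intro e x y z hx hy hz
      have : (((⟨x, hx⟩, ⟨y, hy⟩, ⟨z, hz⟩) : Fin (2 * a) × Fin (2 * a) × Fin (2 * a)) ∈ ppComplement T ↔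
        ((⟨x, hx⟩, ⟨y, hy⟩, ⟨z, hz⟩) : Fin (2 * a) × Fin (2 * a) × Fin (2 * a)) ∈ ppTranspose T) := by rw [e]
      have this : ((Fin.rev ⟨x, hx⟩, Fin.rev ⟨y, hy⟩, Fin.rev ⟨z, hz⟩) ∉ T) ↔
        (((⟨y, hy⟩, ⟨x, hx⟩, ⟨z, hz⟩) : Fin (2 * a) × Fin (2 * a) × Fin (2 * a)) ∈ T) := this
      rw [← mm_fin, ← mm_fin, hr, hr, hr] at this
      exact this
    · intro e
      ext ⟨x, y, z⟩
      have := e x y z x.2 y.2 z.2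
      rw [← hr, ← hr, ← hr, mm_fin, mm_fin] at this
      exact this)
  have hm := main_alg a (fun s t => by rw [← FA_card]; positivity)
  rw [← PS_card, ← PT_card, ← PC_card, ← c2, ← c3] at hm
  simp only [and_true] at c1
  rw [show ({x | x ∈ PS (2 * a)} : Set _) = PS (2 * a) from rfl] at c1
  rw [← c1] at hm
  have e2 : Nat.card {T : Set (Fin (2 * a) × Fin (2 * a) × Fin (2 * a)) //
          IsLowerSet T ∧ ppTranspose T = T ∧ ppCycle T = T} =
      Nat.card ({T | IsLowerSet T ∧ ppCycle T = T ∧ ppTranspose T = T} : Set (Set (Fin (2 * a) × Fin (2 * a) × Fin (2 * a)))) :=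
    Nat.card_congr (Equiv.subtypeEquivRight fun T => by
      constructor
      · rintro ⟨h1, h2, h3⟩; exact ⟨h1, h3, h2⟩
      · rintro ⟨h1, h2, h3⟩; exact ⟨h1, h3, h2⟩)
  rw [e2]
  exact_mod_cast hm

end PP

/-- Equation (1.3): `CS(2a,2a,2a) = TS(2a,2a,2a) · CSTC(2a,2a,2a)`.
Plane partitions in the box are identified with lower sets of
`{0,…,2a−1}³` with the (componentwise) product order.  A lower set is totally symmetric
iff it is both symmetric (equal to its transpose) and cyclically symmetric. -/
theorem cs_eq_ts_mul_cstc (a : ℕ) :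
    Nat.card {T : Set (Fin (2 * a) × Fin (2 * a) × Fin (2 * a)) //
        IsLowerSet T ∧ ppCycle T = T}
      = Nat.card {T : Set (Fin (2 * a) × Fin (2 * a) × Fin (2 * a)) //
          IsLowerSet T ∧ ppTranspose T = T ∧ ppCycle T = T}
        * Nat.card {T : Set (Fin (2 * a) × Fin (2 * a) × Fin (2 * a)) //
            IsLowerSet T ∧ ppCycle T = T ∧ ppComplement T = ppTranspose T} := by
  exact PP.main a
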